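/- arXiv:1606.01955 — 2 statements merged into one kernel-verified Lean document; each statement's English description precedes it below -/
import Mathlib

section
/- Let k and l be coprime integers with k, l ≥ 2. Then the set {(x,y) ∈ ℂ² : x^k + y^l = 1}, equipped with the subspace topology from ℂ², is path-connected but not simply connected. -/
set_option linter.style.haveILetI false
lemma root_lin (l : ℕ) (hl : l ≠ 0) (r : ℂ) :
    ∃ g : ℝ → ℂ, Continuous g ∧ ∀ t : ℝ, g t ^ l = (t : ℂ) - r := by
  have key : ∀ c : ℂ, c ≠ 0 → (∀ t : ℝ, 0 ≤ (((t : ℂ) - r) / c).re) →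
      ∃ g : ℝ → ℂ, Continuous g ∧ ∀ t : ℝ, g t ^ l = (t : ℂ) - r := by
    intro c hc h
    refine ⟨fun t => c ^ ((l : ℂ)⁻¹) * (((t : ℂ) - r) / c) ^ ((l : ℂ)⁻¹), ?_, ?_⟩
    · refine continuous_const.mul (continuous_iff_continuousAt.2 fun t => ?_)
      refine ContinuousAt.comp (f := fun t : ℝ => ((t : ℂ) - r) / c)
        (g := fun z : ℂ => z ^ ((l : ℂ)⁻¹)) ?_ (by fun_prop)
      refine Complex.continuousAt_cpow_const_of_re_pos (Or.inl (h t)) ?_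
      have : (0 : ℝ) < (l : ℝ)⁻¹ := by positivity
      have h2 : ((l : ℂ)⁻¹) = (((l : ℝ)⁻¹ : ℝ) : ℂ) := by push_cast; rfl
      rw [h2, Complex.ofReal_re]; exact this
    · intro t
      simp only [mul_pow, Complex.cpow_nat_inv_pow _ hl]
      field_simp
  rcases le_total 0 r.im with h | h
  · exact key (-Complex.I) (by simp) (fun t => by simp [Complex.div_re]; linarith)
  · exact key Complex.I (by simp) (fun t => by simp [Complex.div_re]; linarith)

open Polynomial in
lemma root_poly (l : ℕ) (hl : l ≠ 0) (Q : ℂ[X]) :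
    ∃ g : ℝ → ℂ, Continuous g ∧ ∀ t : ℝ, g t ^ l = Q.eval (t : ℂ) := by
  have h1 : ∀ s : Multiset ℂ, ∃ g : ℝ → ℂ, Continuous g ∧
      ∀ t : ℝ, g t ^ l = ((s.map fun a => X - C a).prod).eval (t : ℂ) := by
    intro s
    induction s using Multiset.induction_on with
    | empty => exact ⟨fun _ => 1, continuous_const, by simp⟩
    | cons a s ih =>
      obtain ⟨g, hg, hg'⟩ := ih
      obtain ⟨f, hf, hf'⟩ := root_lin l hl a
      exact ⟨fun t => f t * g t, hf.mul hg, fun t => by simp [mul_pow, hf', hg', eval_mul]⟩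
  obtain ⟨g, hg, hg'⟩ := h1 Q.roots
  refine ⟨fun t => Q.leadingCoeff ^ ((l : ℂ)⁻¹) * g t, by fun_prop, fun t => ?_⟩
  conv_rhs => rw [(IsAlgClosed.splits Q).eq_prod_roots]
  simp [mul_pow, hg', Complex.cpow_nat_inv_pow _ hl]

/-- the polynomial P(z) = sum (1 - z^l)^i -/
noncomputable def PP (k l : ℕ) : Polynomial ℂ :=
  ∑ i ∈ Finset.range k, (1 - Polynomial.X ^ l) ^ i

abbrev EE (k l : ℕ) := {v : ℂ × ℂ // v.2 ^ l = (PP k l).eval v.1}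
abbrev XX (k l : ℕ) := {v : ℂ × ℂ | v.1 ^ k + v.2 ^ l = 1}

lemma PP_eval (k l : ℕ) (z : ℂ) :
    (PP k l).eval z = ∑ i ∈ Finset.range k, (1 - z ^ l) ^ i := by
  simp [PP, Polynomial.eval_finsetSum]

lemma PP_geom (k l : ℕ) (z : ℂ) : (PP k l).eval z * z ^ l = 1 - (1 - z ^ l) ^ k := by
  rw [PP_eval]
  have := geom_sum_mul_neg (1 - z ^ l) k
  simpa using this

lemma PP_zero (k l : ℕ) (hl : l ≠ 0) : (PP k l).eval 0 = k := by
  rw [PP_eval]; simp [hl]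

lemma PP_root (k l : ℕ) (hk : 2 ≤ k) (hl : l ≠ 0) : ∃ a, (PP k l).eval a = 0 := by
  have hp := Complex.isPrimitiveRoot_exp k (by omega)
  set ζ := Complex.exp (2 * Real.pi * Complex.I / k)
  refine ⟨(1 - ζ) ^ ((l : ℂ)⁻¹), ?_⟩
  rw [PP_eval, Complex.cpow_nat_inv_pow _ hl]
  simpa using hp.geom_sum_eq_zero (by omega)

lemma EE_pathConnected (k l : ℕ) (hk : 2 ≤ k) (hl : l ≠ 0) : PathConnectedSpace (EE k l) := by
  obtain ⟨a, ha⟩ := PP_root k l hk hl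
  let b : EE k l := ⟨(a, 0), by simp [hl, ha]⟩
  have key : ∀ v : EE k l, Joined v b := by
    rintro ⟨⟨z, w⟩, hw⟩
    simp only at hw
    obtain ⟨g, hg, hg'⟩ := root_poly l hl
      ((PP k l).comp (Polynomial.C z + Polynomial.X * Polynomial.C (a - z)))
    simp only [Polynomial.eval_comp, Polynomial.eval_add, Polynomial.eval_mul,
      Polynomial.eval_C, Polynomial.eval_X] at hg'
    have h1 : g 1 = 0 := by
      have := hg' 1
      simp [ha] at this
      exact this.1
    have h0 : g 0 ^ l = w ^ l := by rw [hg' 0, hw]; simp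
    obtain ⟨η, hη, hη'⟩ : ∃ η : ℂ, η ^ l = 1 ∧ η * g 0 = w := by
      by_cases h : g 0 = 0
      · refine ⟨1, by simp, ?_⟩
        rw [h, zero_pow hl] at h0
        have := pow_eq_zero_iff hl |>.1 h0.symm
        rw [h, this]; simp
      · exact ⟨w / g 0, by rw [div_pow, h0]; exact div_self (by rw [← h0]; exact pow_ne_zero _ h),
          by field_simp⟩
    refine ⟨⟨⟨fun t => ⟨(z + (t : ℝ) * (a - z), η * g t), ?_⟩, ?_⟩, ?_, ?_⟩⟩
    · simp [mul_pow, hη, hg']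
    · fun_prop
    · ext <;> simp [hη']
    · ext <;> simp [h1, b]
  exact ⟨⟨b⟩, fun x y => (key x).trans (key y).symm⟩

@[reducible] noncomputable def EE_action (k l : ℕ) : MulAction (rootsOfUnity l ℂ) (EE k l) where
  smul η v := ⟨(((η : ℂˣ) : ℂ) * v.1.1, (((η⁻¹ : rootsOfUnity l ℂ) : ℂˣ) : ℂ) * v.1.2), by
    have h : ∀ η : rootsOfUnity l ℂ, (((η : ℂˣ) : ℂ)) ^ l = 1 := fun η => by
      have := η.2
      rw [mem_rootsOfUnity] at this
      rw [← Units.val_pow_eq_pow_val, this, Units.val_one]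
    have := v.2
    simp only [PP_eval] at this ⊢
    rw [mul_pow, mul_pow, h, h, one_mul, one_mul, this]⟩
  one_smul v := by
    apply Subtype.ext
    change (_, _) = _
    simp
  mul_smul a b v := by
    apply Subtype.ext
    change (_, _) = (_, _)
    ext
    · change _ = _ * (_ * _)
      simp [mul_assoc]
    · change _ = _ * (_ * _)
      simp [mul_comm, mul_left_comm]

noncomputable def ff (k l : ℕ) (v : EE k l) : XX k l :=
  ⟨(1 - v.1.1 ^ l, v.1.1 * v.1.2), by
    have := PP_geom k l v.1.1
    have h2 := v.2
    simp only [Set.mem_ofPred_eq, mul_pow, h2]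
    linear_combination this⟩

lemma ff_surj (k l : ℕ) (hl : l ≠ 0) : Function.Surjective (ff k l) := by
  rintro ⟨⟨x, y⟩, h⟩
  simp only [Set.mem_ofPred_eq] at h
  obtain ⟨z, hz⟩ : ∃ z : ℂ, z ^ l = 1 - x := ⟨_, Complex.cpow_nat_inv_pow _ hl⟩
  have hg := PP_geom k l z
  rw [hz, sub_sub_cancel] at hg
  by_cases h0 : z = 0
  · subst h0
    rw [zero_pow hl] at hz
    have hx : x = 1 := by linear_combination hz
    subst hx
    have hy : y = 0 := by
      have : y ^ l = 0 := by simpa using h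
      exact (pow_eq_zero_iff hl).1 this
    subst hy
    refine ⟨⟨(0, _), Complex.cpow_nat_inv_pow ((PP k l).eval 0) hl⟩, ?_⟩
    simp [ff, hl]
  · have hzl : z ^ l ≠ 0 := pow_ne_zero _ h0
    refine ⟨⟨(z, y / z), ?_⟩, ?_⟩
    · simp only [div_pow]
      rw [div_eq_iff hzl, hz, hg]
      linear_combination h
    · apply Subtype.ext
      simp [ff, hz]
      field_simp

lemma proper_pow (l : ℕ) (hl : l ≠ 0) : IsProperMap (fun z : ℂ => z ^ l) := by
  rw [isProperMap_iff_tendsto_cocompact]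
  refine ⟨by fun_prop, ?_⟩
  rw [← Metric.cobounded_eq_cocompact, ← comap_norm_atTop, Filter.tendsto_comap_iff]
  simp only [Function.comp_def, norm_pow]
  exact (Filter.tendsto_pow_atTop hl).comp Filter.tendsto_comap

lemma ff_cont (k l : ℕ) : Continuous (ff k l) := by
  unfold ff; fun_prop

lemma EE_closed (k l : ℕ) : IsClosed {v : ℂ × ℂ | v.2 ^ l = (PP k l).eval v.1} :=
  isClosed_eq (by fun_prop) (by fun_prop)

lemma ff_proper (k l : ℕ) (hl : l ≠ 0) : IsProperMap (ff k l) := by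
  have h1 : IsProperMap (fun v : EE k l => ((v.1.1 ^ l, v.1.2 ^ l) : ℂ × ℂ)) :=
    ((proper_pow l hl).prodMap (proper_pow l hl)).comp
      (EE_closed k l).isClosedEmbedding_subtypeVal.isProperMap
  let g : XX k l → ℂ × ℂ := fun v => (1 - v.1.1, ∑ i ∈ Finset.range k, v.1.1 ^ i)
  have hg : Continuous g := by fun_prop
  refine isProperMap_of_comp_of_t2 (ff_cont k l) hg ?_
  convert h1 using 1
  ext v
  · simp [g, ff]
  · simp [g, ff, v.2, PP_eval]

lemma ff_eq_iff (k l : ℕ) (hk : k ≠ 0) (hl : l ≠ 0) (v w : EE k l) :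
    letI := EE_action k l
    ff k l v = ff k l w ↔ v ∈ MulAction.orbit (rootsOfUnity l ℂ) w := by
  letI := EE_action k l
  have h : ∀ η : rootsOfUnity l ℂ, (((η : ℂˣ) : ℂ)) ^ l = 1 := fun η => by
    have := η.2
    rw [mem_rootsOfUnity] at this
    rw [← Units.val_pow_eq_pow_val, this, Units.val_one]
  haveI : NeZero l := ⟨hl⟩
  constructor
  · intro e
    have e1 := congrArg (fun u => u.1.1) e
    have e2 := congrArg (fun u => u.1.2) e
    simp only [ff, sub_right_inj] at e1 e2
    obtain ⟨⟨z, s⟩, hv⟩ := v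
    obtain ⟨⟨z', s'⟩, hw⟩ := w
    simp only at e1 e2 hv hw
    suffices ∃ η : ℂ, η ^ l = 1 ∧ η * z' = z ∧ η⁻¹ * s' = s by
      obtain ⟨η, a, b, c⟩ := this
      refine ⟨rootsOfUnity.mkOfPowEq η a, ?_⟩
      apply Subtype.ext
      change (_ * _, _ * _) = _
      simp [b, c]
    by_cases hz : z' = 0
    · subst hz
      rw [zero_pow hl, pow_eq_zero_iff hl] at e1
      subst e1
      rw [PP_zero _ _ hl] at hv hw
      have hk' : (k : ℂ) ≠ 0 := by exact_mod_cast hk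
      have hs : s ≠ 0 := by rintro rfl; rw [zero_pow hl] at hv; exact hk' hv.symm
      have hs' : s' ≠ 0 := by rintro rfl; rw [zero_pow hl] at hw; exact hk' hw.symm
      exact ⟨s' / s, by rw [div_pow, hv, hw, div_self hk'], by simp, by field_simp⟩
    · have hz2 : z ≠ 0 := by
        rintro rfl
        rw [zero_pow hl] at e1
        exact pow_ne_zero l hz e1.symm
      refine ⟨z / z', by rw [div_pow, e1, div_self (pow_ne_zero _ hz)], by field_simp, ?_⟩
      field_simp
      linear_combination -e2
  · rintro ⟨η, rfl⟩
    apply Subtype.ext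
    change (1 - (_ * _) ^ l, (_ * _) * (_ * _)) = (_, _)
    ext
    · simp [mul_pow, h]
    · simp only [ff, InvMemClass.coe_inv, Units.val_inv_eq_inv_val]
      have := (η : ℂˣ).ne_zero
      field_simp

lemma ff_covering (k l : ℕ) (hk : k ≠ 0) (hl : l ≠ 0) :
    letI := EE_action k l
    IsQuotientCoveringMap (ff k l) (rootsOfUnity l ℂ) := by
  letI := EE_action k l
  haveI : NeZero l := ⟨hl⟩
  haveI : ContinuousConstSMul (rootsOfUnity l ℂ) (EE k l) := ⟨fun η => by
    refine Continuous.subtype_mk (f := fun v : EE k l =>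
      (((η : ℂˣ) : ℂ) * v.1.1, (((η⁻¹ : rootsOfUnity l ℂ) : ℂˣ) : ℂ) * v.1.2)) ?_ _
    fun_prop⟩
  haveI : LocallyCompactSpace (EE k l) :=
    (EE_closed k l).isClosedEmbedding_subtypeVal.locallyCompactSpace
  haveI : IsCancelSMul (rootsOfUnity l ℂ) (EE k l) := by
    rw [isCancelSMul_iff_eq_one_of_smul_eq]
    intro η v e
    have e1 : ((η : ℂˣ) : ℂ) * v.1.1 = v.1.1 := congrArg (fun u => u.1.1) e
    have e2 : (((η⁻¹ : rootsOfUnity l ℂ) : ℂˣ) : ℂ) * v.1.2 = v.1.2 :=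
      congrArg (fun u => u.1.2) e
    by_cases hz : v.1.1 = 0
    · have hs : v.1.2 ≠ 0 := by
        intro hs
        have := v.2
        rw [hz, hs, zero_pow hl, PP_zero _ _ hl] at this
        exact hk (by exact_mod_cast this.symm)
      have := mul_eq_right₀ hs |>.1 e2
      rw [← inv_eq_one]
      exact Subtype.ext (Units.ext this)
    · have := mul_eq_right₀ hz |>.1 e1
      exact Subtype.ext (Units.ext this)
  refine Topology.IsQuotientMap.isQuotientCoveringMap_of_properlyDiscontinuousSMul ?_ ?_
  · exact (ff_proper k l hl).isClosedMap.isQuotientMap (ff_cont k l) (ff_surj k l hl)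
  · exact ff_eq_iff k l hk hl _ _

/-- Topological content of Corollary 4 of the paper: for coprime `k, l ≥ 2`, the affine
curve `x^k + y^l = 1` in `ℂ²` is path-connected but not simply connected. -/
theorem curve_path_connected_not_simply_connected
    (k l : ℕ) (hk : 2 ≤ k) (hl : 2 ≤ l) (hkl : Nat.Coprime k l) :
    PathConnectedSpace ({v : ℂ × ℂ | v.1 ^ k + v.2 ^ l = 1}) ∧
    ¬ SimplyConnectedSpace ({v : ℂ × ℂ | v.1 ^ k + v.2 ^ l = 1}) := by
  have hl0 : l ≠ 0 := by omega
  haveI := EE_pathConnected k l hk hl0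
  refine ⟨(ff_surj k l hl0).pathConnectedSpace (ff_cont k l), fun hS => ?_⟩
  letI := EE_action k l
  have hc := ff_covering k l (by omega) hl0
  obtain ⟨e⟩ : Nonempty (EE k l) := inferInstance
  have hs := hc.fundamentalGroupToMulOpposite_surjective (x := ff k l e) ⟨e, rfl⟩
  haveI : Subsingleton (FundamentalGroup (XX k l) (ff k l e)) :=
    @SimplyConnectedSpace.instSubsingletonFundamentalGroup _ _ hS _
  have h2 : Subsingleton (rootsOfUnity l ℂ)ᵐᵒᵖ := hs.subsingleton
  have h3 : Subsingleton (rootsOfUnity l ℂ) := MulOpposite.op_injective.subsingleton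
  haveI : NeZero l := ⟨hl0⟩
  have h4 := Complex.card_rootsOfUnity l
  have h5 := Finite.card_le_one_iff_subsingleton.2 h3
  omega
end

section
/- Let p ∈ ℂ[x,y] be a polynomial such that the quotient ℂ-algebra ℂ[x,y]/(p) is isomorphic as a ℂ-algebra to ℂ[t]. Then for every complex number c, the quotient ℂ-algebra ℂ[x,y]/(p − c) is also isomorphic as a ℂ-algebra to ℂ[t]; i.e., every fiber of p is isomorphic to an affine line. -/
namespace AMS
open Polynomial

structure DF {A : Type*} [CommRing A] (u : A → WithBot ℤ) : Prop where
  zero : u 0 = ⊥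
  nat : ∀ k : ℕ, k ≠ 0 → u (k : A) = ((0 : ℤ) : WithBot ℤ)
  neg : ∀ a, u (-a) = u a
  mul : ∀ a b, u (a * b) = u a + u b
  add : ∀ a b, u (a + b) ≤ max (u a) (u b)

section basic
variable {A : Type*} [CommRing A] {u : A → WithBot ℤ}

lemma DF.one (h : DF u) : u 1 = ((0 : ℤ) : WithBot ℤ) := by
  simpa using h.nat 1 one_ne_zero

lemma DF.pow (h : DF u) {a : A} {δ : ℤ} (ha : u a = (δ : WithBot ℤ)) (k : ℕ) :
    u (a ^ k) = ((k * δ : ℤ) : WithBot ℤ) := by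
  induction k with
  | zero => simpa using h.one
  | succ k ih =>
    rw [pow_succ, h.mul, ih, ha, ← WithBot.coe_add]
    congr 1
    push_cast
    ring

lemma DF.sub (h : DF u) (a b : A) : u (a - b) ≤ max (u a) (u b) := by
  rw [sub_eq_add_neg, ← h.neg b]
  exact h.add _ _

lemma DF.add_lt (h : DF u) {a b : A} (hab : u a < u b) : u (a + b) = u b := by
  apply le_antisymm
  · exact (h.add a b).trans (max_le hab.le le_rfl)
  · have h2 := h.sub (a + b) a
    rw [add_sub_cancel_left] at h2
    rcases le_max_iff.1 h2 with h3 | h3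
    · exact h3
    · exact absurd h3 (not_le.2 hab)

lemma DF.add_eq (h : DF u) {a b : A} (hab : u a = u b → u a = ⊥) :
    u (a + b) = max (u a) (u b) := by
  rcases lt_trichotomy (u a) (u b) with h1 | h1 | h1
  · rw [h.add_lt h1, max_eq_right h1.le]
  · have h2 := hab h1
    have h3 := h.add a b
    rw [← h1, h2, max_self] at h3 ⊢
    exact le_bot_iff.1 h3
  · rw [add_comm, h.add_lt h1, max_eq_left h1.le]

lemma DF.sum_eq (h : DF u) {ι : Type*} [DecidableEq ι] (s : Finset ι) (F : ι → A)
    (hF : ∀ i ∈ s, ∀ j ∈ s, i ≠ j → u (F i) = u (F j) → u (F i) = ⊥) :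
    u (∑ i ∈ s, F i) = s.sup (fun i => u (F i)) := by
  induction s using Finset.induction_on with
  | empty => simpa using h.zero
  | insert a s ha ih =>
    have ih' := ih (fun i hi j hj => hF i (Finset.mem_insert_of_mem hi) j (Finset.mem_insert_of_mem hj))
    rw [Finset.sum_insert ha, Finset.sup_insert, h.add_eq, ih']
    · intro h1
      rw [ih'] at h1
      rcases s.eq_empty_or_nonempty with rfl | hs
      · simpa using h1
      · obtain ⟨i, hi, h2⟩ := Finset.exists_mem_eq_sup s hs (fun i => u (F i))
        rw [h2] at h1
        exact hF a (Finset.mem_insert_self _ _) i (Finset.mem_insert_of_mem hi)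
          (by rintro rfl; exact ha hi) h1

end basic

section rep
variable {R : Type*} [CommRing R] [Nontrivial R]

lemma exists_rep {q : R[X]} (hq : q.Monic) (k : ℕ) (F : R[X])
    (hF : F.degree < ((q.natDegree * k : ℕ) : WithBot ℕ)) :
    ∃ A : ℕ → R[X], (∀ j, (A j).degree < (q.natDegree : WithBot ℕ)) ∧
      F = ∑ j ∈ Finset.range k, A j * q ^ j := by
  induction k generalizing F with
  | zero =>
    refine ⟨fun _ => 0, fun j => by simp [bot_lt_iff_ne_bot], ?_⟩
    simp at hF
    have : F.degree < 0 := by simpa using hF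
    simpa using this
  | succ k ih =>
    have hd : (F /ₘ q).degree < ((q.natDegree * k : ℕ) : WithBot ℕ) := by
      by_cases h0 : F /ₘ q = 0
      · rw [h0, degree_zero]; exact WithBot.bot_lt_coe _
      have hF0 : F ≠ 0 := by rintro rfl; simp at h0
      rw [degree_eq_natDegree hF0, Nat.cast_lt] at hF
      rw [degree_eq_natDegree h0, Nat.cast_lt, natDegree_divByMonic _ hq]
      have h1 : q.natDegree ≤ F.natDegree := by
        by_contra h2
        apply h0
        rw [divByMonic_eq_zero_iff hq]
        exact natDegree_lt_natDegree_iff hF0 |>.1 (not_le.1 h2)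
      rw [mul_add, mul_one] at hF
      omega
    obtain ⟨A, hA, h1⟩ := ih _ hd
    refine ⟨fun j => Nat.casesOn j (F %ₘ q) A, ?_, ?_⟩
    · intro j
      cases j with
      | zero => simpa [← degree_eq_natDegree hq.ne_zero] using degree_modByMonic_lt F hq
      | succ j => exact hA j
    · rw [Finset.sum_range_succ']
      conv_lhs => rw [← modByMonic_add_div F q, h1, Finset.mul_sum]
      rw [add_comm]
      congr 1
      · refine Finset.sum_congr rfl fun j _ => ?_
        simp only [pow_succ]; ring
      · simp

lemma pow_expand (q E : R[X]) (e : ℕ) (hq : q.natDegree ≤ e) (hE : E.natDegree ≤ e) (m : ℕ) :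
    ∃ T : R[X], T.natDegree ≤ e * m ∧
      (q + E) ^ (m + 2) = q ^ (m + 2) + ((m + 2 : ℕ) : R[X]) * E * q ^ (m + 1) + E ^ 2 * T := by
  induction m with
  | zero => exact ⟨1, by simp, by push_cast; ring⟩
  | succ m ih =>
    obtain ⟨T, hT, h⟩ := ih
    refine ⟨((m + 2 : ℕ) : R[X]) * q ^ (m + 1) + T * (q + E), ?_, ?_⟩
    · refine natDegree_add_le_of_degree_le ?_ ?_
      · refine natDegree_mul_le.trans ?_
        rw [natDegree_natCast, zero_add]
        refine natDegree_pow_le.trans ?_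
        rw [mul_comm]; exact Nat.mul_le_mul_right _ hq
      · refine natDegree_mul_le.trans ?_
        rw [mul_add, mul_one]
        exact add_le_add hT (natDegree_add_le_of_degree_le hq hE)
    · rw [pow_succ, h]; push_cast; ring

end rep
end AMS

namespace AMS
open Polynomial

section W
variable {K : Type*} [Field K]

/-- level condition -/
def Lev (u : K[X] → WithBot ℤ) (e d : ℕ) : Prop :=
  ∀ A : K[X], A.degree < (e : WithBot ℕ) → u A = ⊥ ∨ ∃ k : ℤ, u A = ((d * k : ℤ) : WithBot ℤ)

/-- key polynomial at a level -/
structure Key (u : K[X] → WithBot ℤ) (e d : ℕ) (q : K[X]) (δ : ℤ) : Prop where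
  monic : q.Monic
  deg : q.natDegree = e
  val : u q = (δ : WithBot ℤ)
  ndvd : ¬ (d : ℤ) ∣ δ

noncomputable def WW (u : K[X] → WithBot ℤ) (q : K[X]) (δ c : ℤ) : AddSubgroup K[X] :=
  AddSubgroup.closure {F | ∃ (A : K[X]) (j : ℕ), A.degree < (q.natDegree : WithBot ℕ) ∧
    u A ≤ ((c - j * δ : ℤ) : WithBot ℤ) ∧ F = A * q ^ j}

variable {u : K[X] → WithBot ℤ} {e d : ℕ} {q : K[X]} {δ : ℤ}

lemma Lev.ne (hL : Lev u e d) (hk : Key u e d q δ) {A B : K[X]} (hA : A.degree < (e : WithBot ℕ))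
    (hB : B.degree < (e : WithBot ℕ)) (hu : DF u) (h : u A = u (q * B)) : u A = ⊥ := by
  rcases hL A hA with h1 | ⟨k, h1⟩
  · exact h1
  rcases hL B hB with h2 | ⟨l, h2⟩
  · rw [h, hu.mul, h2, WithBot.add_bot]
  · exfalso
    rw [hu.mul, h1, h2, hk.val, ← WithBot.coe_add, WithBot.coe_inj] at h
    exact hk.ndvd ⟨k - l, by linear_combination -h⟩

lemma divmod_deg (hk : Key u e d q δ) (he : 0 < e) {A B : K[X]} (hA : A.degree < (e : WithBot ℕ))
    (hB : B.degree < (e : WithBot ℕ)) : ((A * B) /ₘ q).degree < (e : WithBot ℕ) := by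
  by_cases h0 : (A * B) /ₘ q = 0
  · rw [h0, degree_zero]; exact WithBot.bot_lt_coe _
  have hAB : A * B ≠ 0 := by intro h; rw [h] at h0; simp at h0
  have hA0 := left_ne_zero_of_mul hAB
  have hB0 := right_ne_zero_of_mul hAB
  rw [degree_eq_natDegree hA0, Nat.cast_lt] at hA
  rw [degree_eq_natDegree hB0, Nat.cast_lt] at hB
  rw [degree_eq_natDegree h0, Nat.cast_lt, natDegree_divByMonic _ hk.monic, hk.deg,
    natDegree_mul hA0 hB0]
  omega

lemma mul_split (hu : DF u) (hL : Lev u e d) (hk : Key u e d q δ) (he : 0 < e) {A B : K[X]}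
    (hA : A.degree < (e : WithBot ℕ)) (hB : B.degree < (e : WithBot ℕ)) {c : ℤ}
    (hc : u (A * B) ≤ (c : WithBot ℤ)) :
    u ((A * B) %ₘ q) ≤ (c : WithBot ℤ) ∧ u ((A * B) /ₘ q) ≤ ((c - δ : ℤ) : WithBot ℤ) := by
  have h1 : ((A * B) %ₘ q).degree < (e : WithBot ℕ) := by
    have := degree_modByMonic_lt (A * B) hk.monic
    rwa [degree_eq_natDegree hk.monic.ne_zero, hk.deg] at this
  have h2 := divmod_deg hk he hA hB
  have h3 := hu.add_eq (a := (A * B) %ₘ q) (b := q * ((A * B) /ₘ q)) (hL.ne hk h1 h2 hu)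
  rw [modByMonic_add_div] at h3
  rw [h3] at hc
  obtain ⟨h4, h5⟩ := max_le_iff.1 hc
  refine ⟨h4, ?_⟩
  rcases hL _ h2 with h6 | ⟨l, h6⟩
  · rw [h6]; exact bot_le
  · rw [hu.mul, hk.val, h6, ← WithBot.coe_add, WithBot.coe_le_coe] at h5
    rw [h6, WithBot.coe_le_coe]; linarith

lemma WW.mono (c c' : ℤ) (h : c ≤ c') : WW u q δ c ≤ WW u q δ c' := by
  apply AddSubgroup.closure_mono
  rintro F ⟨A, j, h1, h2, h3⟩
  exact ⟨A, j, h1, h2.trans (WithBot.coe_le_coe.2 (by linarith)), h3⟩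

lemma WW.gen {A : K[X]} (hA : A.degree < (q.natDegree : WithBot ℕ)) (j : ℕ) {c : ℤ}
    (h : u A ≤ ((c - j * δ : ℤ) : WithBot ℤ)) : A * q ^ j ∈ WW u q δ c :=
  AddSubgroup.subset_closure ⟨A, j, hA, h, rfl⟩

lemma WW.mul (hu : DF u) (hL : Lev u e d) (hk : Key u e d q δ) (he : 0 < e) {F G : K[X]}
    {c c' : ℤ} (hF : F ∈ WW u q δ c) (hG : G ∈ WW u q δ c') : F * G ∈ WW u q δ (c + c') := by
  induction hF using AddSubgroup.closure_induction with
  | zero => rw [zero_mul]; exact zero_mem _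
  | add x y _ _ hx hy => rw [add_mul]; exact add_mem hx hy
  | neg x _ hx => rw [neg_mul]; exact neg_mem hx
  | mem x hx =>
    obtain ⟨A, i, hA, hA2, rfl⟩ := hx
    induction hG using AddSubgroup.closure_induction with
    | zero => rw [mul_zero]; exact zero_mem _
    | add x y _ _ hx hy => rw [mul_add]; exact add_mem hx hy
    | neg x _ hx => rw [mul_neg]; exact neg_mem hx
    | mem x hx =>
      obtain ⟨B, j, hB, hB2, rfl⟩ := hx
      rw [hk.deg] at hA hB
      have h1 : u (A * B) ≤ (((c - i * δ) + (c' - j * δ) : ℤ) : WithBot ℤ) := by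
        rw [hu.mul, WithBot.coe_add]; exact add_le_add hA2 hB2
      obtain ⟨h2, h3⟩ := mul_split hu hL hk he hA hB h1
      have h4 : A * q ^ i * (B * q ^ j) =
          ((A * B) %ₘ q) * q ^ (i + j) + ((A * B) /ₘ q) * q ^ (i + j + 1) := by
        conv_lhs => rw [show A * q ^ i * (B * q ^ j) = (A * B) * q ^ (i + j) by ring,
          ← modByMonic_add_div (A * B) q]
        ring
      rw [h4]
      refine add_mem (WW.gen ?_ _ ?_) (WW.gen ?_ _ ?_)
      · have := degree_modByMonic_lt (A * B) hk.monic
        rwa [degree_eq_natDegree hk.monic.ne_zero] at this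
      · convert h2 using 2; push_cast; ring
      · rw [hk.deg]; exact divmod_deg hk he hA hB
      · convert h3 using 2; push_cast; ring

lemma WW.one_mem (hu : DF u) (hk : Key u e d q δ) (he : 0 < e) : (1 : K[X]) ∈ WW u q δ 0 := by
  have := WW.gen (u := u) (q := q) (δ := δ) (A := 1) (c := 0)
    (by rw [hk.deg, degree_one]; exact_mod_cast he) 0
    (by rw [hu.one]; simp)
  simpa using this

lemma WW.pow (hu : DF u) (hL : Lev u e d) (hk : Key u e d q δ) (he : 0 < e) {F : K[X]}
    {c : ℤ} (hF : F ∈ WW u q δ c) (k : ℕ) : F ^ k ∈ WW u q δ (k * c) := by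
  induction k with
  | zero => simpa using WW.one_mem hu hk he
  | succ k ih =>
    rw [pow_succ]
    convert WW.mul hu hL hk he ih hF using 1
    push_cast; ring_nf

lemma WW.q_mem (hu : DF u) (hk : Key u e d q δ) (he : 0 < e) : q ∈ WW u q δ δ := by
  have := WW.gen (u := u) (q := q) (δ := δ) (A := 1) (c := δ)
    (by rw [hk.deg, degree_one]; exact_mod_cast he) 1
    (by rw [hu.one]; simp)
  simpa using this

lemma WW.divmod (hu : DF u) (hk : Key u e d q δ) {F : K[X]}
    {c : ℤ} (hF : F ∈ WW u q δ c) :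
    u (F %ₘ q) ≤ (c : WithBot ℤ) ∧ F /ₘ q ∈ WW u q δ (c - δ) := by
  have hq := hk.monic
  induction hF using AddSubgroup.closure_induction with
  | zero => simp [hu.zero]
  | add x y _ _ hx hy =>
    have := div_modByMonic_unique (f := x + y) (g := q) (x /ₘ q + y /ₘ q) (x %ₘ q + y %ₘ q) hq
      ⟨by
        conv_rhs => rw [← modByMonic_add_div x q, ← modByMonic_add_div y q]
        ring, (degree_add_le _ _).trans_lt (max_lt (degree_modByMonic_lt _ hq)
          (degree_modByMonic_lt _ hq))⟩
    rw [this.1, this.2]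
    exact ⟨(hu.add _ _).trans (max_le hx.1 hy.1), add_mem hx.2 hy.2⟩
  | neg x _ hx =>
    have := div_modByMonic_unique (f := - x) (g := q) (-(x /ₘ q)) (-(x %ₘ q)) hq
      ⟨by
        conv_rhs => rw [← modByMonic_add_div x q]
        ring, by rw [degree_neg]; exact degree_modByMonic_lt _ hq⟩
    rw [this.1, this.2, hu.neg]
    exact ⟨hx.1, neg_mem hx.2⟩
  | mem x hx =>
    obtain ⟨A, i, hA, hA2, rfl⟩ := hx
    rw [← degree_eq_natDegree hq.ne_zero] at hA
    cases i with
    | zero =>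
      have := div_modByMonic_unique (f := A * q ^ 0) (g := q) 0 A hq ⟨by simp, hA⟩
      rw [this.1, this.2]
      exact ⟨by simpa using hA2, zero_mem _⟩
    | succ i =>
      have := div_modByMonic_unique (f := A * q ^ (i + 1)) (g := q) (A * q ^ i) 0 hq
        ⟨by ring, by rw [degree_zero]; exact bot_lt_iff_ne_bot.2 (by
          rw [Ne, degree_eq_bot]; exact hq.ne_zero)⟩
      rw [this.1, this.2, hu.zero]
      refine ⟨bot_le, WW.gen (by rwa [← degree_eq_natDegree hq.ne_zero]) _ ?_⟩
      convert hA2 using 2; push_cast; ring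

lemma WW.rep (hu : DF u) (hk : Key u e d q δ) (k : ℕ) {F : K[X]}
    {c : ℤ} (hF : F ∈ WW u q δ c) (hd : F.degree < ((e * k : ℕ) : WithBot ℕ)) :
    ∃ A : ℕ → K[X], (∀ j, (A j).degree < (e : WithBot ℕ) ∧
        u (A j) ≤ ((c - j * δ : ℤ) : WithBot ℤ)) ∧
      F = ∑ j ∈ Finset.range k, A j * q ^ j := by
  have hq := hk.monic
  induction k generalizing F c with
  | zero =>
    refine ⟨fun _ => 0, fun j => by simp [bot_lt_iff_ne_bot, hu.zero], ?_⟩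
    simp at hd
    have : F.degree < 0 := by simpa using hd
    simpa using this
  | succ k ih =>
    have hd' : (F /ₘ q).degree < ((e * k : ℕ) : WithBot ℕ) := by
      by_cases h0 : F /ₘ q = 0
      · rw [h0, degree_zero]; exact WithBot.bot_lt_coe _
      have hF0 : F ≠ 0 := by rintro rfl; simp at h0
      rw [degree_eq_natDegree hF0, Nat.cast_lt] at hd
      rw [degree_eq_natDegree h0, Nat.cast_lt, natDegree_divByMonic _ hq]
      have h1 : q.natDegree ≤ F.natDegree := by
        by_contra h2
        apply h0
        rw [divByMonic_eq_zero_iff hq]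
        exact natDegree_lt_natDegree_iff hF0 |>.1 (not_le.1 h2)
      rw [mul_add, mul_one] at hd
      rw [hk.deg] at *
      omega
    obtain ⟨h1, h2⟩ := WW.divmod hu hk hF
    obtain ⟨A, hA, h3⟩ := ih h2 hd'
    refine ⟨fun j => Nat.casesOn j (F %ₘ q) A, ?_, ?_⟩
    · intro j
      cases j with
      | zero =>
        refine ⟨?_, by simpa using h1⟩
        have := degree_modByMonic_lt F hq
        rwa [degree_eq_natDegree hq.ne_zero, hk.deg] at this
      | succ j =>
        refine ⟨(hA j).1, ?_⟩
        convert (hA j).2 using 2; push_cast; ring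
    · rw [Finset.sum_range_succ']
      conv_lhs => rw [← modByMonic_add_div F q, h3, Finset.mul_sum]
      rw [add_comm]
      congr 1
      · refine Finset.sum_congr rfl fun j _ => ?_
        simp only [pow_succ]; ring
      · simp

/-- distinctness of values -/
lemma Lev.distinct (hu : DF u) {d' n' : ℕ} {δ' : ℤ} (hL : Lev u e (d' * n'))
    (hd' : 0 < d') (hv : u q = ((d' * δ' : ℤ) : WithBot ℤ)) (hco : IsCoprime (n' : ℤ) δ')
    (A : ℕ → K[X]) (hA : ∀ j, (A j).degree < (e : WithBot ℕ)) :
    ∀ i ∈ Finset.range n', ∀ j ∈ Finset.range n', i ≠ j →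
      u (A i * q ^ i) = u (A j * q ^ j) → u (A i * q ^ i) = ⊥ := by
  intro i hi j hj hij h
  rcases hL _ (hA i) with h1 | ⟨k, h1⟩
  · rw [hu.mul, h1, WithBot.bot_add]
  rcases hL _ (hA j) with h2 | ⟨l, h2⟩
  · rw [h, hu.mul, h2, WithBot.bot_add]
  exfalso
  rw [hu.mul, hu.mul, h1, h2, hu.pow hv, hu.pow hv, ← WithBot.coe_add, ← WithBot.coe_add,
    WithBot.coe_inj] at h
  have h3 : (n' : ℤ) ∣ ((i : ℤ) - j) * δ' := by
    refine ⟨l - k, ?_⟩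
    have : (d' : ℤ) ≠ 0 := by exact_mod_cast hd'.ne'
    apply mul_left_cancel₀ this
    push_cast at h
    linear_combination h
  have h4 := hco.dvd_of_dvd_mul_right h3
  rw [Finset.mem_range] at hi hj
  have h5 : |(i : ℤ) - j| < n' := by rw [abs_lt]; omega
  have := Int.eq_zero_of_abs_lt_dvd h4 h5
  omega

/-- next level -/
lemma Lev.next (hu : DF u) {d' n' : ℕ} {δ' : ℤ} (hL : Lev u e (d' * n'))
    (hd' : 0 < d') (hk : Key u e (d' * n') q (d' * δ')) (hco : IsCoprime (n' : ℤ) δ') :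
    Lev u (e * n') d' ∧ ∀ (F : K[X]) (c : ℤ), F.degree < ((e * n' : ℕ) : WithBot ℕ) →
      u F ≤ (c : WithBot ℤ) → F ∈ WW u q (d' * δ') c := by
  have key : ∀ (F : K[X]), F.degree < ((e * n' : ℕ) : WithBot ℕ) → ∃ A : ℕ → K[X],
      (∀ j, (A j).degree < (e : WithBot ℕ)) ∧ F = ∑ j ∈ Finset.range n', A j * q ^ j ∧
      u F = (Finset.range n').sup (fun i => u (A i * q ^ i)) := by
    intro F hF
    obtain ⟨A, hA, h1⟩ := exists_rep hk.monic n' F (by rw [hk.deg]; exact hF)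
    rw [hk.deg] at hA
    refine ⟨A, hA, h1, ?_⟩
    conv_lhs => rw [h1]
    exact hu.sum_eq _ _ (hL.distinct hu hd' hk.val hco A hA)
  constructor
  · intro F hF
    obtain ⟨A, hA, h1, h2⟩ := key F hF
    rcases (Finset.range n').eq_empty_or_nonempty with hs | hs
    · left; rw [h2, hs, Finset.sup_empty]
    · obtain ⟨i, hi, h3⟩ := Finset.exists_mem_eq_sup _ hs (fun i => u (A i * q ^ i))
      rw [h2, h3]
      rcases hL _ (hA i) with h4 | ⟨k, h4⟩
      · left; rw [hu.mul, h4, WithBot.bot_add]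
      · right
        refine ⟨n' * k + i * δ', ?_⟩
        rw [hu.mul, h4, hu.pow hk.val, ← WithBot.coe_add, WithBot.coe_inj]
        push_cast; ring
  · intro F c hF hc
    obtain ⟨A, hA, h1, h2⟩ := key F hF
    rw [h1]
    refine sum_mem fun j hj => WW.gen (by rw [hk.deg]; exact hA j) _ ?_
    have h3 : u (A j * q ^ j) ≤ (c : WithBot ℤ) :=
      le_trans (by rw [h2]; exact Finset.le_sup (f := fun i => u (A i * q ^ i)) hj) hc
    rcases hL _ (hA j) with h4 | ⟨k, h4⟩
    · rw [h4]; exact bot_le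
    · rw [hu.mul, h4, hu.pow hk.val, ← WithBot.coe_add, WithBot.coe_le_coe] at h3
      rw [h4, WithBot.coe_le_coe]; linarith

/-- arithmetic: split d -/
lemma split_gcd {d : ℕ} (hd : 0 < d) (δ : ℤ) (h : ¬ (d : ℤ) ∣ δ) : ∃ (d' n' : ℕ) (δ' : ℤ),
    d = d' * n' ∧ δ = d' * δ' ∧ IsCoprime (n' : ℤ) δ' ∧ 0 < d' ∧ 2 ≤ n' := by
  have hg : 0 < Int.gcd (d : ℤ) δ := Int.gcd_pos_of_ne_zero_left _ (by exact_mod_cast hd.ne')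
  obtain ⟨a, b, h1, h2, h3⟩ := Int.exists_gcd_one hg
  set g := Int.gcd (d : ℤ) δ with hgdef
  have ha : 0 < a := by
    by_contra hc
    have : (d : ℤ) ≤ 0 := by rw [h2]; exact mul_nonpos_of_nonpos_of_nonneg (not_lt.1 hc) (by positivity)
    omega
  lift a to ℕ using ha.le
  refine ⟨g, a, b, ?_, by rw [mul_comm]; exact h3, ?_, hg, ?_⟩
  · rw [mul_comm]; exact_mod_cast h2
  · exact Int.isCoprime_iff_gcd_eq_one.2 h1
  · by_contra hc
    have ha1 : a = 1 := by have : 0 < a := by exact_mod_cast ha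
                           omega
    apply h
    rw [h2, ha1, h3]
    simp

end W
end AMS

namespace AMS
open Polynomial

section approx
variable {K : Type*} [Field K] {u : K[X] → WithBot ℤ}

lemma Key.le_next (hu : DF u) {e' d' : ℕ} {q' F : K[X]} {δ' c : ℤ} (hL' : Lev u e' d')
    (hk' : Key u e' d' q' δ') (hF : F.Monic) (hFd : F.natDegree = e')
    (hc : u F = (c : WithBot ℤ)) :
    δ' ≤ c ∧ u (q' - F) ≤ (c : WithBot ℤ) := by
  have hd : (q' - F).degree < (e' : WithBot ℕ) := by
    have h0 : q'.degree = F.degree := by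
      rw [degree_eq_natDegree hk'.monic.ne_zero, degree_eq_natDegree hF.ne_zero, hk'.deg, hFd]
    have := degree_sub_lt h0 hk'.monic.ne_zero (by rw [hk'.monic.leadingCoeff, hF.leadingCoeff])
    rwa [degree_eq_natDegree hk'.monic.ne_zero, hk'.deg] at this
  have hne : u (q' - F) ≠ u q' := by
    rw [hk'.val]
    intro h
    rcases hL' _ hd with h1 | ⟨k, h1⟩
    · rw [h1] at h; exact WithBot.bot_ne_coe h
    · rw [h1, WithBot.coe_inj] at h
      exact hk'.ndvd ⟨k, h.symm⟩
  have h2 := hu.add_eq (a := -(q' - F)) (b := q') (by rw [hu.neg]; intro h; exact absurd h hne)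
  rw [show -(q' - F) + q' = F by ring, hu.neg, hc, hk'.val] at h2
  constructor
  · rw [← WithBot.coe_le_coe, h2]; exact le_max_right _ _
  · rw [h2]; exact le_max_left _ _

theorem P_mem (hu : DF u) {n : ℕ} (hn : 0 < n) {P : K[X]} (hP : P.Monic) (hPn : P.natDegree = n)
    (hPu : u P = ⊥)
    (hE : ∀ e d : ℕ, 2 ≤ d → e * d = n → Lev u e d → ∃ q δ, Key u e d q δ) :
    ∀ (d e : ℕ) (q : K[X]) (δ : ℤ), e * d = n → Lev u e d → Key u e d q δ →
      P ∈ WW u q δ (d * δ) := by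
  intro d
  induction d using Nat.strong_induction_on with
  | _ d ih =>
  intro e q δ hed hL hk
  have hd : 0 < d := Nat.pos_of_ne_zero (by rintro rfl; simp at hed; omega)
  have he : 0 < e := Nat.pos_of_ne_zero (by rintro rfl; simp at hed; omega)
  obtain ⟨d', n', δ', rfl, rfl, hco, hd', hn'⟩ := split_gcd hd δ hk.ndvd
  obtain ⟨hL', hW⟩ := hL.next hu hd' hk hco
  have hqd : (q ^ n').Monic := hk.monic.pow _
  have hqn : (q ^ n').natDegree = e * n' := by rw [hk.monic.natDegree_pow, hk.deg, mul_comm]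
  have hqm : ∀ k : ℕ, q ^ k ∈ WW u q (d' * δ') (k * (d' * δ')) :=
    fun k => WW.pow hu hL hk he (WW.q_mem hu hk he) k
  by_cases h1 : d' = 1
  · subst h1
    have hd1 : (P - q ^ n').degree < ((e * n' : ℕ) : WithBot ℕ) := by
      have h0 : P.degree = (q ^ n').degree := by
        rw [degree_eq_natDegree hP.ne_zero, degree_eq_natDegree hqd.ne_zero, hPn, hqn, ← hed, one_mul]
      have := degree_sub_lt h0 hP.ne_zero (by rw [hP.leadingCoeff, hqd.leadingCoeff])
      rwa [h0, degree_eq_natDegree hqd.ne_zero, hqn] at this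
    have h2 : u (P - q ^ n') ≤ ((n' * ((1 : ℕ) * δ') : ℤ) : WithBot ℤ) := by
      refine (hu.sub _ _).trans ?_
      rw [hPu, hu.pow hk.val]
      simp
    have h3 := add_mem (hW _ _ hd1 h2) (hqm n')
    rw [sub_add_cancel] at h3
    convert h3 using 2
    push_cast; ring
  · obtain ⟨q', ε, hk'⟩ := hE (e * n') d' (by omega) (by rw [← hed]; ring) hL'
    have h2 := ih d' (by nlinarith) (e * n') q' ε (by rw [← hed]; ring) hL' hk'
    obtain ⟨h3, h4⟩ := Key.le_next hu hL' hk' hqd hqn (hu.pow hk.val n')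
    have hdq : (q' - q ^ n').degree < ((e * n' : ℕ) : WithBot ℕ) := by
      have h0 : q'.degree = (q ^ n').degree := by
        rw [degree_eq_natDegree hk'.monic.ne_zero, degree_eq_natDegree hqd.ne_zero, hk'.deg, hqn]
      have := degree_sub_lt h0 hk'.monic.ne_zero (by rw [hk'.monic.leadingCoeff, hqd.leadingCoeff])
      rwa [degree_eq_natDegree hk'.monic.ne_zero, hk'.deg] at this
    have hq' : q' ∈ WW u q (d' * δ') (n' * (d' * δ')) := by
      have := add_mem (hW _ _ hdq h4) (hqm n')
      rwa [sub_add_cancel] at this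
    have hdP : P.degree < ((e * n' * (d' + 1) : ℕ) : WithBot ℕ) := by
      rw [degree_eq_natDegree hP.ne_zero, hPn, Nat.cast_lt, ← hed]
      have : 0 < e * n' := by positivity
      nlinarith
    obtain ⟨A, hA, h5⟩ := WW.rep hu hk' (d' + 1) h2 hdP
    rw [h5]
    refine sum_mem fun j hj => ?_
    have hj' : j ≤ d' := by rw [Finset.mem_range] at hj; omega
    have h6 := hW (A j) (((d' - j : ℕ) : ℤ) * (n' * (d' * δ'))) (hA j).1 (by
      refine (hA j).2.trans (WithBot.coe_le_coe.2 ?_)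
      rw [Nat.cast_sub hj', ← sub_mul]
      exact mul_le_mul_of_nonneg_left h3 (by have : (j : ℤ) ≤ d' := by exact_mod_cast hj'
                                             linarith))
    have h7 := WW.mul hu hL hk he h6 (WW.pow hu hL hk he hq' j)
    convert h7 using 2
    rw [Nat.cast_sub hj']
    push_cast; ring

lemma lt_of_natDegree {R : Type*} [Semiring R] {F : R[X]} {N : ℕ} (h : F.natDegree < N) :
    F.degree < (N : WithBot ℕ) :=
  degree_le_natDegree.trans_lt (Nat.cast_lt.2 h)

theorem exists_approx [CharZero K] (hu : DF u) {n : ℕ} (hn : 0 < n) {P : K[X]} (hP : P.Monic)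
    (hPn : P.natDegree = n) (hPu : u P = ⊥)
    (hE : ∀ e d : ℕ, 2 ≤ d → e * d = n → Lev u e d → ∃ q δ, Key u e d q δ)
    (e m : ℕ) (hed : e * (m + 2) = n) (hL : Lev u e (m + 2)) :
    ∃ q δ, Key u e (m + 2) q δ ∧ (P - q ^ (m + 2)).degree < ((e * (m + 1) : ℕ) : WithBot ℕ) := by
  have he : 0 < e := Nat.pos_of_ne_zero (by rintro rfl; simp at hed; omega)
  have key : ∀ (k : ℕ) (q : K[X]) (δ : ℤ), Key u e (m + 2) q δ →
      (P - q ^ (m + 2)).degree < ((e * (m + 1) + k : ℕ) : WithBot ℕ) →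
      ∃ q δ, Key u e (m + 2) q δ ∧ (P - q ^ (m + 2)).degree < ((e * (m + 1) : ℕ) : WithBot ℕ) := by
    intro k
    induction k with
    | zero => intro q δ hk h; exact ⟨q, δ, hk, h⟩
    | succ k ih =>
      intro q δ hk h
      have hqd : (q ^ (m + 2)).Monic := hk.monic.pow _
      have hqn : (q ^ (m + 2)).natDegree = e * (m + 2) := by
        rw [hk.monic.natDegree_pow, hk.deg, mul_comm]
      have hd1 : (P - q ^ (m + 2)).degree < ((e * (m + 2) : ℕ) : WithBot ℕ) := by
        have h0 : P.degree = (q ^ (m + 2)).degree := by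
          rw [degree_eq_natDegree hP.ne_zero, degree_eq_natDegree hqd.ne_zero, hPn, hqn, ← hed]
        have := degree_sub_lt h0 hP.ne_zero (by rw [hP.leadingCoeff, hqd.leadingCoeff])
        rwa [h0, degree_eq_natDegree hqd.ne_zero, hqn] at this
      have hmem : P - q ^ (m + 2) ∈ WW u q δ (((m + 2 : ℕ) : ℤ) * δ) :=
        sub_mem (P_mem hu hn hP hPn hPu hE _ _ _ _ hed hL hk)
          (WW.pow hu hL hk he (WW.q_mem hu hk he) _)
      obtain ⟨A, hA, h5⟩ := WW.rep hu hk (m + 2) hmem hd1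
      rw [Finset.sum_range_succ] at h5
      set S := ∑ j ∈ Finset.range (m + 1), A j * q ^ j with hS
      set E := A (m + 1) with hEdef
      have hSd : S.degree < ((e * (m + 1) : ℕ) : WithBot ℕ) := by
        refine (degree_sum_le _ _).trans_lt ((Finset.sup_lt_iff (WithBot.bot_lt_coe _)).2 ?_)
        intro j hj
        rw [Finset.mem_range] at hj
        by_cases h0 : A j = 0
        · rw [h0, zero_mul, degree_zero]; exact WithBot.bot_lt_coe _
        have h1 := (hA j).1
        rw [degree_eq_natDegree h0, Nat.cast_lt] at h1
        apply lt_of_natDegree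
        refine natDegree_mul_le.trans_lt ?_
        rw [hk.monic.natDegree_pow, hk.deg]
        have : (j + 1) * e ≤ (m + 1) * e := Nat.mul_le_mul_right _ (by omega)
        nlinarith
      have hEe : E.degree < (e : WithBot ℕ) := (hA _).1
      have hEe' : E.natDegree < e := by
        by_cases h0 : E = 0
        · rw [h0]; simpa using he
        · rwa [degree_eq_natDegree h0, Nat.cast_lt] at hEe
      have hEk : E.natDegree ≤ k := by
        by_cases h0 : E = 0
        · rw [h0]; simp
        have h1 : (E * q ^ (m + 1)).degree < ((e * (m + 1) + (k + 1) : ℕ) : WithBot ℕ) := by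
          rw [show E * q ^ (m + 1) = (P - q ^ (m + 2)) - S by rw [h5]; ring]
          refine (degree_sub_le _ _).trans_lt (max_lt h (hSd.trans_le ?_))
          exact_mod_cast Nat.le_add_right _ _
        rw [degree_eq_natDegree (mul_ne_zero h0 (hk.monic.pow _).ne_zero), Nat.cast_lt,
          natDegree_mul h0 (hk.monic.pow _).ne_zero, hk.monic.natDegree_pow, hk.deg, mul_comm e] at h1
        omega
      have hm0 : ((m + 2 : ℕ) : K) ≠ 0 := by exact_mod_cast (by omega : m + 2 ≠ 0)
      set E' := C (((m + 2 : ℕ) : K)⁻¹) * E with hE'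
      have hE'E : ((m + 2 : ℕ) : K[X]) * E' = E := by
        rw [hE', ← mul_assoc, ← C_eq_natCast, ← C_mul, mul_inv_cancel₀ hm0, C_1, one_mul]
      have hE'n : E'.natDegree ≤ E.natDegree := natDegree_C_mul_le _ _
      have hE'd : E'.degree < (e : WithBot ℕ) := lt_of_natDegree (hE'n.trans_lt hEe')
      have hE'q : E'.degree < q.degree := by
        rwa [degree_eq_natDegree hk.monic.ne_zero, hk.deg]
      have hE'u : u E' < (δ : WithBot ℤ) := by
        have h1 : u E = u E' := by
          rw [← hE'E, hu.mul, hu.nat _ (by omega)]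
          exact zero_add _
        have h2 := (hA (m + 1)).2
        rw [← hEdef, h1] at h2
        refine lt_of_le_of_ne (h2.trans (WithBot.coe_le_coe.2 (by push_cast; linarith))) ?_
        intro h3
        rcases hL _ hE'd with h4 | ⟨l, h4⟩
        · rw [h4] at h3; exact WithBot.bot_ne_coe h3
        · rw [h4, WithBot.coe_inj] at h3; exact hk.ndvd ⟨l, h3.symm⟩
      have hk2 : Key u e (m + 2) (q + E') δ :=
        { monic := hk.monic.add_of_left hE'q
          deg := by rw [natDegree_add_eq_left_of_degree_lt hE'q, hk.deg]
          val := by rw [add_comm, hu.add_lt (by rw [hk.val]; exact hE'u), hk.val]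
          ndvd := hk.ndvd }
      refine ih (q + E') δ hk2 ?_
      obtain ⟨T, hT, hT2⟩ := pow_expand q E' e hk.deg.le (by omega) m
      have h8 : P - (q + E') ^ (m + 2) = S - E' ^ 2 * T := by
        rw [hT2, hE'E]
        linear_combination h5
      rw [h8]
      refine (degree_sub_le _ _).trans_lt (max_lt (hSd.trans_le ?_) ?_)
      · exact_mod_cast Nat.le_add_right _ _
      · apply lt_of_natDegree
        refine natDegree_mul_le.trans_lt ?_
        have := natDegree_pow_le (p := E') (n := 2)
        rw [mul_add, mul_one]
        omega
  obtain ⟨q, δ, hk⟩ := hE e (m + 2) (by omega) hed hL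
  refine key (e * (m + 2) + 1) q δ hk (lt_of_natDegree ?_)
  refine (natDegree_sub_le _ _).trans_lt (max_lt ?_ ?_)
  · omega
  · rw [hk.monic.natDegree_pow, hk.deg, mul_comm]; omega

end approx

/-- approximate roots exist over rings where the index is invertible -/
lemma approx_exists {R : Type*} [CommRing R] [Nontrivial R] {e m : ℕ} (he : 0 < e) {P : R[X]} (hP : P.Monic)
    (hPn : P.natDegree = e * (m + 2)) (r : R) (hr : ((m + 2 : ℕ) : R) * r = 1) :
    ∃ Q : R[X], Q.Monic ∧ Q.natDegree = e ∧
      (P - Q ^ (m + 2)).degree < ((e * (m + 1) : ℕ) : WithBot ℕ) := by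
  have key : ∀ k, k ≤ e → ∀ Q : R[X], Q.Monic → Q.natDegree = e →
      (P - Q ^ (m + 2)).degree < ((e * (m + 1) + k : ℕ) : WithBot ℕ) →
      ∃ Q : R[X], Q.Monic ∧ Q.natDegree = e ∧
        (P - Q ^ (m + 2)).degree < ((e * (m + 1) : ℕ) : WithBot ℕ) := by
    intro k
    induction k with
    | zero => intro _ Q h1 h2 h3; exact ⟨Q, h1, h2, h3⟩
    | succ k ih =>
      intro hke Q h1 h2 h3
      set c := (P - Q ^ (m + 2)).coeff (e * (m + 1) + k) with hc
      set E := C (r * c) * X ^ k with hE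
      have hEn : E.natDegree ≤ k := natDegree_C_mul_X_pow_le _ _
      have hEq : E.degree < Q.degree := by
        rw [degree_eq_natDegree h1.ne_zero, h2]; exact lt_of_natDegree (by omega)
      refine ih (by omega) (Q + E) (h1.add_of_left hEq)
        (by rw [natDegree_add_eq_left_of_degree_lt hEq, h2]) ?_
      obtain ⟨T, hT, hT2⟩ := pow_expand Q E e h2.le (by omega) m
      have h4 : ((m + 2 : ℕ) : R[X]) * E = C c * X ^ k := by
        rw [hE, ← mul_assoc, ← C_eq_natCast, ← C_mul, ← mul_assoc, hr, one_mul]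
      have h5 : P - (Q + E) ^ (m + 2) = (P - Q ^ (m + 2)) - C c * X ^ k * Q ^ (m + 1) - E ^ 2 * T := by
        rw [hT2, h4]; ring
      rw [h5]
      have hN : (E ^ 2 * T).natDegree < e * (m + 1) + k := by
        refine natDegree_mul_le.trans_lt ?_
        have := natDegree_pow_le (p := E) (n := 2)
        rw [mul_add, mul_one]
        omega
      have hQn : (Q ^ (m + 1)).natDegree = e * (m + 1) := by
        rw [h1.natDegree_pow, h2, mul_comm]
      rw [degree_lt_iff_coeff_zero] at h3 ⊢
      intro l hl
      rw [coeff_sub, coeff_sub, coeff_eq_zero_of_natDegree_lt (hN.trans_le hl), sub_zero]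
      rcases hl.eq_or_lt with rfl | hl
      · rw [← hc, mul_assoc, coeff_C_mul, coeff_X_pow_mul, ← hQn, coeff_natDegree,
          (h1.pow _).leadingCoeff, mul_one, sub_self]
      · rw [h3 l (by omega), coeff_eq_zero_of_natDegree_lt, sub_zero]
        refine lt_of_le_of_lt natDegree_mul_le ?_
        rw [hQn]
        have := natDegree_C_mul_X_pow_le (R := R) c k
        omega
  refine key e le_rfl (X ^ e) (monic_X_pow e) (natDegree_X_pow e) ?_
  have hqd : ((X ^ e : R[X]) ^ (m + 2)).Monic := (monic_X_pow e).pow _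
  have hqn : ((X ^ e : R[X]) ^ (m + 2)).natDegree = e * (m + 2) := by
    rw [(monic_X_pow e).natDegree_pow, natDegree_X_pow, mul_comm]
  have h0 : P.degree = ((X ^ e : R[X]) ^ (m + 2)).degree := by
    rw [degree_eq_natDegree hP.ne_zero, degree_eq_natDegree hqd.ne_zero, hPn, hqn]
  have := degree_sub_lt h0 hP.ne_zero (by rw [hP.leadingCoeff, hqd.leadingCoeff])
  rw [h0, degree_eq_natDegree hqd.ne_zero, hqn] at this
  exact this

lemma approx_unique {K : Type*} [Field K] [CharZero K] {e m : ℕ} {P q Q : K[X]}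
    (hq : q.Monic) (hQ : Q.Monic) (hqe : q.natDegree = e) (hQe : Q.natDegree = e)
    (h1 : (P - q ^ (m + 2)).degree < ((e * (m + 1) : ℕ) : WithBot ℕ))
    (h2 : (P - Q ^ (m + 2)).degree < ((e * (m + 1) : ℕ) : WithBot ℕ)) : q = Q := by
  by_contra hne
  have hsub : q - Q ≠ 0 := sub_ne_zero.2 hne
  set E := q - Q with hE
  have hEd : E.degree < (e : WithBot ℕ) := by
    have h0 : q.degree = Q.degree := by
      rw [degree_eq_natDegree hq.ne_zero, degree_eq_natDegree hQ.ne_zero, hqe, hQe]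
    have := degree_sub_lt h0 hq.ne_zero (by rw [hq.leadingCoeff, hQ.leadingCoeff])
    rwa [degree_eq_natDegree hq.ne_zero, hqe] at this
  rw [degree_eq_natDegree hsub, Nat.cast_lt] at hEd
  obtain ⟨T, hT, hT2⟩ := pow_expand Q E e hQe.le hEd.le m
  have h3 : (((m + 2 : ℕ) : K[X]) * E * Q ^ (m + 1) + E ^ 2 * T).degree <
      ((e * (m + 1) : ℕ) : WithBot ℕ) := by
    have : ((m + 2 : ℕ) : K[X]) * E * Q ^ (m + 1) + E ^ 2 * T =
        (P - Q ^ (m + 2)) - (P - q ^ (m + 2)) := by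
      rw [show q = Q + E by rw [hE]; ring, hT2]; ring
    rw [this]
    exact (degree_sub_le _ _).trans_lt (max_lt h2 h1)
  rw [degree_lt_iff_coeff_zero] at h3
  have h4 := h3 (E.natDegree + e * (m + 1)) (by omega)
  have hQn : (Q ^ (m + 1)).natDegree = e * (m + 1) := by
    rw [hQ.natDegree_pow, hQe, mul_comm]
  rw [coeff_add, coeff_eq_zero_of_natDegree_lt (p := E ^ 2 * T), add_zero, mul_assoc,
    ← C_eq_natCast, coeff_C_mul, ← hQn, coeff_mul_degree_add_degree, (hQ.pow _).leadingCoeff, mul_one] at h4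
  · rcases mul_eq_zero.1 h4 with h5 | h5
    · have : ((m + 2 : ℕ) : K) ≠ 0 := by exact_mod_cast (by omega : m + 2 ≠ 0)
      exact this h5
    · exact hsub (leadingCoeff_eq_zero.1 h5)
  · refine natDegree_mul_le.trans_lt ?_
    have := natDegree_pow_le (p := E) (n := 2)
    rw [mul_add, mul_one]
    omega

end AMS

namespace AMS
open Polynomial

lemma exists_minpoly {R S : Type*} [CommRing R] [IsDomain R] [IsIntegrallyClosed R] [CommRing S]
    [IsDomain S] (i : R →+* S) (hi : Function.Injective i) (s : S) (hs : i.IsIntegralElem s) :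
    ∃ P : R[X], P.Monic ∧ eval₂ i s P = 0 ∧
      ∀ F : R[X], eval₂ i s F = 0 → F.degree < P.degree → F = 0 := by
  let := i.toAlgebra
  have : FaithfulSMul R S := (faithfulSMul_iff_algebraMap_injective R S).2 hi
  have hs' : IsIntegral R s := hs
  refine ⟨minpoly R s, minpoly.monic hs', minpoly.aeval R s, ?_⟩
  intro F hF hd
  by_contra h0
  exact absurd hd (not_lt.2 (minpoly.IsIntegrallyClosed.degree_le_of_ne_zero (s := s) h0 hF))

lemma comp_inj (f : ℂ[X]) (hf : 0 < f.natDegree) : Function.Injective (compRingHom f) := by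
  rw [injective_iff_map_eq_zero]
  intro a ha
  rw [coe_compRingHom_apply] at ha
  rw [comp_eq_zero_iff] at ha
  rcases ha with h | ⟨_, h⟩
  · exact h
  · rw [h] at hf; simp at hf

lemma integral_elem (f : ℂ[X]) (hf : 0 < f.natDegree) (g : ℂ[X]) :
    (compRingHom f).IsIntegralElem g := by
  have hX : (compRingHom f).IsIntegralElem X := by
    have hf0 : f ≠ 0 := by rintro rfl; simp at hf
    have hl : f.leadingCoeff ≠ 0 := leadingCoeff_ne_zero.2 hf0
    set a := C (f.leadingCoeff⁻¹) * f with ha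
    have ham : a.Monic := monic_C_mul_of_mul_leadingCoeff_eq_one (by field_simp)
    have hn : a.natDegree = f.natDegree := natDegree_C_mul (inv_ne_zero hl)
    refine ⟨a.map C - C (C (f.leadingCoeff⁻¹) * X), ?_, ?_⟩
    · apply Monic.sub_of_left (ham.map C)
      refine degree_C_le.trans_lt ?_
      rw [degree_map_eq_of_injective C_injective, degree_eq_natDegree ham.ne_zero, hn]
      exact_mod_cast hf
    · rw [eval₂_sub, eval₂_map, eval₂_C]
      have : (compRingHom f).comp C = (C : ℂ →+* ℂ[X]) := by ext; simp
      rw [this, eval₂_C_X]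
      simp [ha]
  induction g using Polynomial.induction_on' with
  | add p q hp hq => exact RingHom.IsIntegralElem.add _ hp hq
  | monomial k a =>
    rw [← C_mul_X_pow_eq_monomial]
    refine RingHom.IsIntegralElem.mul _ ?_ ?_
    · have : (C a : ℂ[X]) = compRingHom f (C a) := by simp
      rw [this]
      exact RingHom.isIntegralElem_map _
    · induction k with
      | zero => rw [pow_zero]; exact RingHom.isIntegralElem_one _
      | succ k ih => rw [pow_succ]; exact RingHom.IsIntegralElem.mul _ ih hX

noncomputable def psi (f g : ℂ[X]) : ℂ[X][X] →+* ℂ[X] := eval₂RingHom (compRingHom f) g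

noncomputable abbrev toK (F : ℂ[X][X]) : (RatFunc ℂ)[X] := F.map (algebraMap ℂ[X] (RatFunc ℂ))

open Classical in
noncomputable def vv (z : RatFunc ℂ) : WithBot ℤ := if z = 0 then ⊥ else (z.intDegree : WithBot ℤ)

lemma vv_zero : vv 0 = ⊥ := by rw [vv, if_pos rfl]

lemma vv_ne {z : RatFunc ℂ} (h : z ≠ 0) : vv z = (z.intDegree : WithBot ℤ) := by rw [vv, if_neg h]

lemma vv_DF : DF vv where
  zero := vv_zero
  nat k hk := by
    have h0 : (k : RatFunc ℂ) ≠ 0 := by exact_mod_cast hk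
    rw [vv_ne h0]
    have : (k : RatFunc ℂ) = RatFunc.C (k : ℂ) := by simp
    rw [this, RatFunc.intDegree_C]
  neg a := by
    by_cases ha : a = 0
    · rw [ha, neg_zero]
    · rw [vv_ne ha, vv_ne (neg_ne_zero.2 ha), RatFunc.intDegree_neg]
  mul a b := by
    by_cases ha : a = 0
    · rw [ha, zero_mul, vv_zero, WithBot.bot_add]
    by_cases hb : b = 0
    · rw [hb, mul_zero, vv_zero, WithBot.add_bot]
    rw [vv_ne ha, vv_ne hb, vv_ne (mul_ne_zero ha hb), RatFunc.intDegree_mul ha hb, WithBot.coe_add]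
  add a b := by
    by_cases ha : a = 0
    · rw [ha, zero_add]; exact le_max_right _ _
    by_cases hb : b = 0
    · rw [hb, add_zero]; exact le_max_left _ _
    by_cases hab : a + b = 0
    · rw [hab, vv_zero]; exact bot_le
    rw [vv_ne ha, vv_ne hb, vv_ne hab]
    have := RatFunc.intDegree_add_le hb hab
    exact_mod_cast this

lemma exists_u (f g : ℂ[X]) (hf : 0 < f.natDegree) : ∃ u : (RatFunc ℂ)[X] → WithBot ℤ, DF u ∧
    (∀ F, psi f g F = 0 → u (toK F) = ⊥) ∧
    (∀ F, psi f g F ≠ 0 → u (toK F) = (((psi f g F).natDegree : ℤ) : WithBot ℤ)) := by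
  have hinj : Function.Injective ((algebraMap ℂ[X] (RatFunc ℂ)).comp (compRingHom f)) := by
    rw [RingHom.coe_comp]
    exact (RatFunc.algebraMap_injective ℂ).comp (comp_inj f hf)
  set i : RatFunc ℂ →+* RatFunc ℂ := IsFractionRing.lift hinj with hi
  set φ := eval₂RingHom i (algebraMap ℂ[X] (RatFunc ℂ) g) with hφ
  have h1 : ∀ F, φ (toK F) = algebraMap ℂ[X] (RatFunc ℂ) (psi f g F) := by
    intro F
    rw [hφ, coe_eval₂RingHom, eval₂_map, psi, coe_eval₂RingHom, hom_eval₂]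
    congr 1
    refine RingHom.ext fun x => ?_
    rw [RingHom.comp_apply, hi, IsFractionRing.lift_algebraMap]
  have hv := vv_DF
  refine ⟨fun F => vv (φ F), ⟨?_, ?_, ?_, ?_, ?_⟩, ?_, ?_⟩
  · simp only [map_zero]; exact hv.zero
  · intro k hk; simp only [map_natCast]; exact hv.nat k hk
  · intro a; simp only [map_neg]; exact hv.neg _
  · intro a b; simp only [map_mul]; exact hv.mul _ _
  · intro a b; simp only [map_add]; exact hv.add _ _
  · intro F hF
    simp only [h1, hF, map_zero]; exact hv.zero
  · intro F hF
    simp only [h1]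
    rw [vv_ne, RatFunc.intDegree_polynomial]
    exact fun h => hF ((FaithfulSMul.algebraMap_eq_zero_iff _ _).1 h)

end AMS

namespace AMS
open Polynomial

section count
variable {f g : ℂ[X]} {N : ℕ}

lemma psi_CC (a : ℂ) : psi f g (C (C a)) = C a := by simp [psi]

lemma psi_C (a : ℂ[X]) : psi f g (C a) = a.comp f := by simp [psi]

lemma psi_X : psi f g X = g := by simp [psi]

/-- each degree yields a new class -/
lemma new_class (hf : 0 < f.natDegree)
    (hN : ∀ F : ℂ[X][X], psi f g F = 0 → F.degree < (N : WithBot ℕ) → F = 0)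
    (i : ℕ) (hi : i < N) (S : Finset ℕ)
    (hS : ∀ r ∈ S, ∃ B : ℂ[X][X], B.degree < (i : WithBot ℕ) ∧ psi f g B ≠ 0 ∧
      (psi f g B).natDegree % f.natDegree = r) :
    ∃ (F : ℂ[X][X]) (k : ℕ), F.natDegree ≤ i ∧ F.coeff i = X ^ k ∧ psi f g F ≠ 0 ∧
      (psi f g F).natDegree % f.natDegree ∉ S := by
  by_contra hcon
  push Not at hcon
  have hf0 : f ≠ 0 := by rintro rfl; simp at hf
  have hne : ∀ (F : ℂ[X][X]) (k : ℕ), F.natDegree ≤ i → F.coeff i = X ^ k → psi f g F ≠ 0 := by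
    intro F k h1 h2 h3
    have h4 := hN F h3 (lt_of_natDegree (h1.trans_lt hi))
    rw [h4, coeff_zero] at h2
    exact pow_ne_zero k X_ne_zero h2.symm
  choose! B hB1 hB2 hB3 using hS
  set N0 := ∑ r ∈ S, (psi f g (B r)).natDegree + 1 with hN0
  have red : ∀ (M : ℕ) (F : ℂ[X][X]) (k : ℕ), (psi f g F).natDegree ≤ M → F.natDegree ≤ i →
      F.coeff i = X ^ k → ∃ F : ℂ[X][X], F.natDegree ≤ i ∧ F.coeff i = X ^ k ∧
        (psi f g F).natDegree < N0 := by
    intro M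
    induction M with
    | zero => intro F k h1 h2 h3; exact ⟨F, h2, h3, by omega⟩
    | succ M ih =>
      intro F k h1 h2 h3
      by_cases h4 : (psi f g F).natDegree < N0
      · exact ⟨F, h2, h3, h4⟩
      have hF0 := hne F k h2 h3
      have hr := hcon F k h2 h3 hF0
      set r := (psi f g F).natDegree % f.natDegree with hrdef
      have h5 : (psi f g (B r)).natDegree ≤ (psi f g F).natDegree := by
        have := Finset.single_le_sum (f := fun r => (psi f g (B r)).natDegree)
          (fun _ _ => Nat.zero_le _) hr
        exact le_trans this (by omega)
      have h6 : f.natDegree ∣ (psi f g F).natDegree - (psi f g (B r)).natDegree :=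
        (Nat.modEq_iff_dvd' h5).1 (hB3 r hr)
      obtain ⟨l, hl⟩ := h6
      set lam := (psi f g F).leadingCoeff / (f ^ l * psi f g (B r)).leadingCoeff with hlam
      have hb0 : f ^ l * psi f g (B r) ≠ 0 := mul_ne_zero (pow_ne_zero _ hf0) (hB2 r hr)
      have hlb : (f ^ l * psi f g (B r)).leadingCoeff ≠ 0 := leadingCoeff_ne_zero.2 hb0
      have hlf : (psi f g F).leadingCoeff ≠ 0 := leadingCoeff_ne_zero.2 hF0
      have hlam0 : lam ≠ 0 := div_ne_zero hlf hlb
      set G := C (C lam * X ^ l) * B r with hG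
      have hGd : G.degree < (i : WithBot ℕ) :=
        lt_of_le_of_lt (by
          rw [hG]
          refine (degree_mul_le _ _).trans ?_
          calc _ ≤ 0 + (B r).degree := by gcongr; exact degree_C_le
            _ = _ := zero_add _) (hB1 r hr)
      have hGp : psi f g G = C lam * (f ^ l * psi f g (B r)) := by
        rw [hG, map_mul, psi_C]; simp [mul_assoc]
      have hGn : (psi f g G).degree = (psi f g F).degree := by
        rw [hGp, degree_C_mul hlam0, degree_eq_natDegree hb0, degree_eq_natDegree hF0,
          natDegree_mul (pow_ne_zero _ hf0) (hB2 r hr), natDegree_pow]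
        congr 1
        rw [mul_comm l]; omega
      have hlt : (psi f g (F - G)).degree < (psi f g F).degree := by
        rw [map_sub]
        refine degree_sub_lt_left hGn.symm hF0 ?_
        rw [hGp, leadingCoeff_mul, leadingCoeff_C, hlam]
        field_simp
      have hc1 : (F - G).natDegree ≤ i := by
        refine (natDegree_sub_le _ _).trans (max_le h2 ?_)
        exact natDegree_le_of_degree_le hGd.le
      have hc2 : (F - G).coeff i = X ^ k := by
        rw [coeff_sub, h3, coeff_eq_zero_of_degree_lt hGd, sub_zero]
      have hlt' := natDegree_lt_natDegree (hne _ k hc1 hc2) hlt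
      exact ih (F - G) k (by omega) hc1 hc2
  have hz : ∀ k : ℕ, ∃ F : ℂ[X][X], F.natDegree ≤ i ∧ F.coeff i = X ^ k ∧
        (psi f g F).natDegree < N0 := by
    intro k
    refine red _ (C (X ^ k) * X ^ i) k le_rfl (natDegree_C_mul_X_pow_le _ _) ?_
    simp only [coeff_C_mul, coeff_X_pow, if_true, mul_one]
  choose z hz1 hz2 hz3 using hz
  let w : Fin (N0 + 1) → degreeLT ℂ N0 := fun k => ⟨psi f g (z k), mem_degreeLT.2 (lt_of_natDegree (hz3 k))⟩
  have hli : LinearIndependent ℂ w := by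
    rw [Fintype.linearIndependent_iff]
    intro a ha j
    have h1 : ∑ k, C (a k) * psi f g (z k) = 0 := by
      have := congrArg Subtype.val ha
      simpa [w, smul_eq_C_mul] using this
    have h2 : psi f g (∑ k : Fin (N0 + 1), C (C (a k)) * z k) = 0 := by
      rw [map_sum, ← h1]
      refine Finset.sum_congr rfl fun k _ => ?_
      rw [map_mul, psi_CC]
    have h3 := hN _ h2 (by
      apply lt_of_natDegree
      refine lt_of_le_of_lt (natDegree_sum_le_of_forall_le _ _ fun k _ => ?_) hi
      exact (natDegree_C_mul_le _ _).trans (hz1 k))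
    have h4 := congrArg (fun F => (F.coeff i).coeff (j : ℕ)) h3
    simp only [finset_sum_coeff, coeff_C_mul, hz2, coeff_X_pow, coeff_zero] at h4
    simpa [Fin.val_inj] using h4
  haveI : Module.Finite ℂ (degreeLT ℂ N0) := Module.Finite.equiv (degreeLTEquiv ℂ N0).symm
  have h1 := hli.fintype_card_le_finrank
  rw [(degreeLTEquiv ℂ N0).finrank_eq] at h1
  simp at h1

lemma classes (hf : 0 < f.natDegree)
    (hN : ∀ F : ℂ[X][X], psi f g F = 0 → F.degree < (N : WithBot ℕ) → F = 0)
    (i : ℕ) (hi : i ≤ N) : ∃ S : Finset ℕ, S.card = i ∧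
    ∀ r ∈ S, r < f.natDegree ∧ ∃ B : ℂ[X][X], B.degree < (i : WithBot ℕ) ∧ psi f g B ≠ 0 ∧
      (psi f g B).natDegree % f.natDegree = r := by
  induction i with
  | zero => exact ⟨∅, by simp⟩
  | succ i ih =>
    obtain ⟨S, h1, h2⟩ := ih (by omega)
    obtain ⟨F, k, h3, h4, h5, h6⟩ := new_class hf hN i (by omega) S (fun r hr => (h2 r hr).2)
    refine ⟨insert _ S, by rw [Finset.card_insert_of_notMem h6, h1], ?_⟩
    intro r hr
    rcases Finset.mem_insert.1 hr with rfl | hr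
    · exact ⟨Nat.mod_lt _ hf, F, lt_of_natDegree (by omega), h5, rfl⟩
    · obtain ⟨h7, B, h8, h9⟩ := h2 r hr
      exact ⟨h7, B, h8.trans (by exact_mod_cast Nat.lt_succ_self i), h9⟩

end count

section main
variable {f g : ℂ[X]} {u : (RatFunc ℂ)[X] → WithBot ℤ}

lemma u_C (hf : 0 < f.natDegree) (hu : DF u) 
    (hu2 : ∀ F, psi f g F ≠ 0 → u (toK F) = (((psi f g F).natDegree : ℤ) : WithBot ℤ))
    (k : RatFunc ℂ) (hk : k ≠ 0) : ∃ l : ℤ, u (C k) = ((f.natDegree * l : ℤ) : WithBot ℤ) := by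
  have hpol : ∀ a : ℂ[X], a ≠ 0 → u (C (algebraMap ℂ[X] (RatFunc ℂ) a)) =
      ((f.natDegree * a.natDegree : ℤ) : WithBot ℤ) := by
    intro a ha
    have h1 := hu2 (C a) (by
      rw [psi_C]; intro h; exact ha ((injective_iff_map_eq_zero _).1 (comp_inj f hf) a h))
    rw [psi_C, natDegree_comp, toK, map_C] at h1
    rw [h1]; congr 1; push_cast; ring
  obtain ⟨a, b, hb, rfl⟩ := IsFractionRing.div_surjective (A := ℂ[X]) k
  have hb0 : b ≠ 0 := nonZeroDivisors.ne_zero hb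
  have ha0 : a ≠ 0 := by rintro rfl; simp at hk
  have hb1 : algebraMap ℂ[X] (RatFunc ℂ) b ≠ 0 := by
    intro h; exact hb0 ((FaithfulSMul.algebraMap_eq_zero_iff _ _).1 h)
  refine ⟨a.natDegree - b.natDegree, ?_⟩
  have h1 : u (C (algebraMap ℂ[X] (RatFunc ℂ) a / algebraMap ℂ[X] (RatFunc ℂ) b)) +
      u (C (algebraMap ℂ[X] (RatFunc ℂ) b)) = u (C (algebraMap ℂ[X] (RatFunc ℂ) a)) := by
    rw [← hu.mul, ← C_mul, div_mul_cancel₀ _ hb1]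
  rw [hpol a ha0, hpol b hb0] at h1
  generalize u (C (algebraMap ℂ[X] (RatFunc ℂ) a / algebraMap ℂ[X] (RatFunc ℂ) b)) = x at h1 ⊢
  cases x with
  | bot => rw [WithBot.bot_add] at h1; exact absurd h1 WithBot.bot_ne_coe
  | coe x =>
    rw [← WithBot.coe_add, WithBot.coe_inj] at h1
    rw [WithBot.coe_inj]
    linear_combination h1

lemma lev_one (hf : 0 < f.natDegree) (hu : DF u) 
    (hu2 : ∀ F, psi f g F ≠ 0 → u (toK F) = (((psi f g F).natDegree : ℤ) : WithBot ℤ)) :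
    Lev u 1 f.natDegree := by
  intro A hA
  have : A = C (A.coeff 0) := eq_C_of_degree_le_zero (by
    by_cases h0 : A = 0
    · rw [h0, degree_zero]; exact bot_le
    rw [degree_eq_natDegree h0] at hA ⊢
    have : A.natDegree < 1 := by exact_mod_cast hA
    exact_mod_cast (by omega : A.natDegree ≤ 0))
  rw [this]
  by_cases h0 : A.coeff 0 = 0
  · left; rw [h0, C_0, hu.zero]
  · right; exact u_C hf hu hu2 _ h0

lemma degree_toK (F : ℂ[X][X]) : (toK F).degree = F.degree :=
  degree_map_eq_of_injective (RatFunc.algebraMap_injective ℂ) F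

lemma rank_le (hf : 0 < f.natDegree) (hu : DF u)
    (hu2 : ∀ F, psi f g F ≠ 0 → u (toK F) = (((psi f g F).natDegree : ℤ) : WithBot ℤ))
    (hs : Function.Surjective (psi f g)) {P : ℂ[X][X]} (hP : P.Monic) (hP0 : psi f g P = 0) :
    f.natDegree ≤ P.natDegree := by
  set n := f.natDegree with hn
  have h1 : ∀ r : Fin n, ∃ F : ℂ[X][X], F.degree < (P.natDegree : WithBot ℕ) ∧ psi f g F = X ^ (r : ℕ) := by
    intro r
    obtain ⟨F, hF⟩ := hs (X ^ (r : ℕ))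
    refine ⟨F %ₘ P, ?_, ?_⟩
    · rw [← degree_eq_natDegree hP.ne_zero]; exact degree_modByMonic_lt _ hP
    · have := congrArg (psi f g) (modByMonic_add_div F P)
      rw [map_add, map_mul, hP0, zero_mul, add_zero, hF] at this
      exact this
  choose F hF1 hF2 using h1
  let w : Fin n → degreeLT (RatFunc ℂ) P.natDegree := fun r => ⟨toK (F r), mem_degreeLT.2 (by
    rw [degree_toK]; exact hF1 r)⟩
  have huF : ∀ r, u (toK (F r)) = ((r : ℤ) : WithBot ℤ) := by
    intro r
    rw [hu2 _ (by rw [hF2]; exact pow_ne_zero _ X_ne_zero), hF2, natDegree_X_pow]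
  have hli : LinearIndependent (RatFunc ℂ) w := by
    rw [Fintype.linearIndependent_iff]
    intro a ha j
    have h2 : ∑ k, C (a k) * toK (F k) = 0 := by
      have := congrArg Subtype.val ha
      simpa [w, smul_eq_C_mul] using this
    have hval : ∀ k, a k ≠ 0 → ∃ l : ℤ, u (C (a k) * toK (F k)) = ((n * l + (k : ℕ) : ℤ) : WithBot ℤ) := by
      intro k hk
      obtain ⟨l, hl⟩ := u_C hf hu hu2 _ hk
      exact ⟨l, by rw [hu.mul, hl, huF, ← WithBot.coe_add]⟩
    have hbot : ∀ k, a k = 0 → u (C (a k) * toK (F k)) = ⊥ := by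
      intro k hk; rw [hk, C_0, zero_mul, hu.zero]
    have h3 := hu.sum_eq Finset.univ (fun k => C (a k) * toK (F k)) (by
      intro i _ j _ hij h
      by_cases hai : a i = 0
      · exact hbot i hai
      by_cases haj : a j = 0
      · rw [h]; exact hbot j haj
      exfalso
      obtain ⟨l, hl⟩ := hval i hai
      obtain ⟨l', hl'⟩ := hval j haj
      rw [hl, hl', WithBot.coe_inj] at h
      have h4 : (n : ℤ) ∣ ((i : ℕ) : ℤ) - ((j : ℕ) : ℤ) := ⟨l' - l, by linear_combination h⟩
      have h5 : |((i : ℕ) : ℤ) - ((j : ℕ) : ℤ)| < n := by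
        have := i.2
        have := j.2
        rw [abs_lt]; omega
      have := Int.eq_zero_of_abs_lt_dvd h4 h5
      apply hij
      ext; omega)
    rw [h2, hu.zero] at h3
    by_contra haj
    obtain ⟨l, hl⟩ := hval j haj
    have h6 := Finset.le_sup (f := fun k => u (C (a k) * toK (F k))) (Finset.mem_univ j)
    rw [← h3] at h6
    simp only [hl] at h6
    exact absurd (le_bot_iff.1 h6).symm WithBot.bot_ne_coe
  haveI : Module.Finite (RatFunc ℂ) (degreeLT (RatFunc ℂ) P.natDegree) :=
    Module.Finite.equiv (degreeLTEquiv _ _).symm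
  have h1 := hli.fintype_card_le_finrank
  rw [(degreeLTEquiv (RatFunc ℂ) P.natDegree).finrank_eq] at h1
  simpa using h1

lemma exists_key (hf : 0 < f.natDegree) (hu : DF u)
    (hu2 : ∀ F, psi f g F ≠ 0 → u (toK F) = (((psi f g F).natDegree : ℤ) : WithBot ℤ))
    (hN : ∀ F : ℂ[X][X], psi f g F = 0 → F.degree < (f.natDegree : WithBot ℕ) → F = 0) :
    ∀ e d : ℕ, 2 ≤ d → e * d = f.natDegree → Lev u e d → ∃ q δ, Key u e d q δ := by
  intro e d hd hed hL
  set n := f.natDegree with hn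
  have he : e < n := by
    have : 0 < e := Nat.pos_of_ne_zero (by rintro rfl; simp at hed; omega)
    nlinarith
  obtain ⟨S, hS1, hS2⟩ := classes hf hN e he.le
  have hSsub : S ⊆ (Finset.range e).image (fun i => i * d) := by
    intro r hr
    obtain ⟨hrn, B, hB1, hB2, hB3⟩ := hS2 r hr
    have h1 : d ∣ (psi f g B).natDegree := by
      have h2 := hu2 B hB2
      rcases hL (toK B) (by rw [degree_toK]; exact hB1) with h3 | ⟨k, h3⟩
      · rw [h3] at h2; exact absurd h2 WithBot.bot_ne_coe
      · rw [h3, WithBot.coe_inj] at h2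
        exact Int.natCast_dvd_natCast.1 (Dvd.intro k h2)
    have h4 : d ∣ r := by
      rw [← hB3]
      exact (Nat.dvd_mod_iff ⟨e, by rw [← hn, ← hed, mul_comm]⟩).2 h1
    obtain ⟨c, rfl⟩ := h4
    refine Finset.mem_image.2 ⟨c, Finset.mem_range.2 ?_, mul_comm _ _⟩
    rw [← hn, ← hed, mul_comm e] at hrn
    exact lt_of_mul_lt_mul_left hrn (Nat.zero_le _)
  have hSeq : S = (Finset.range e).image (fun i => i * d) := by
    apply Finset.eq_of_subset_of_card_le hSsub
    rw [hS1]
    exact Finset.card_image_le.trans (by simp)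
  obtain ⟨F, k, h3, h4, h5, h6⟩ := new_class hf hN e he S (fun r hr => (hS2 r hr).2)
  have hnd : ¬ d ∣ (psi f g F).natDegree := by
    intro hdv
    apply h6
    have h7 : d ∣ (psi f g F).natDegree % n :=
      (Nat.dvd_mod_iff ⟨e, by rw [← hed, mul_comm]⟩).2 hdv
    obtain ⟨c, hc⟩ := h7
    rw [hSeq, ← hn, hc]
    refine Finset.mem_image.2 ⟨c, Finset.mem_range.2 ?_, mul_comm _ _⟩
    have h8 := Nat.mod_lt (psi f g F).natDegree hf
    rw [hc, ← hed, mul_comm e] at h8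
    exact lt_of_mul_lt_mul_left h8 (Nat.zero_le _)
  set x := algebraMap ℂ[X] (RatFunc ℂ) (X ^ k) with hx
  have hx0 : x ≠ 0 := by
    intro h
    exact pow_ne_zero k X_ne_zero ((FaithfulSMul.algebraMap_eq_zero_iff _ _).1 h)
  obtain ⟨l, hl⟩ := u_C hf hu hu2 x⁻¹ (inv_ne_zero hx0)
  have hdeg : (C x⁻¹ * toK F).natDegree ≤ e := by
    refine (natDegree_C_mul_le _ _).trans ?_
    exact natDegree_map_le.trans h3
  have hco : (C x⁻¹ * toK F).coeff e = 1 := by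
    rw [coeff_C_mul, coeff_map, h4, ← hx, inv_mul_cancel₀ hx0]
  have hdeg' : (C x⁻¹ * toK F).natDegree = e :=
    le_antisymm hdeg (le_natDegree_of_ne_zero (by rw [hco]; exact one_ne_zero))
  refine ⟨C x⁻¹ * toK F, n * l + (psi f g F).natDegree, ?_, hdeg', ?_, ?_⟩
  · rw [Monic, leadingCoeff, hdeg', hco]
  · rw [hu.mul, hl, hu2 F h5, ← WithBot.coe_add]
  · intro h
    apply hnd
    have h9 : (d : ℤ) ∣ (n : ℤ) * l := by
      rw [← hed]; exact ⟨e * l, by push_cast; ring⟩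
    exact_mod_cast (dvd_add_right h9).1 h

/-- every admissible value is attained in low degree -/
lemma descend (hf : 0 < f.natDegree) (hu : DF u)
    (hu1 : ∀ F, psi f g F = 0 → u (toK F) = ⊥)
    (hu2 : ∀ F, psi f g F ≠ 0 → u (toK F) = (((psi f g F).natDegree : ℤ) : WithBot ℤ))
    {P : ℂ[X][X]} (hP : P.Monic) (hP0 : psi f g P = 0) (hPn : P.natDegree = f.natDegree)
    (hN : ∀ F : ℂ[X][X], psi f g F = 0 → F.degree < (f.natDegree : WithBot ℕ) → F = 0)
    (w : ℂ[X][X]) (D : ℕ) (hw : w.degree < (f.natDegree : WithBot ℕ))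
    (hwD : u (toK w) = ((D : ℤ) : WithBot ℤ)) :
    ∀ d e : ℕ, e * d = f.natDegree → Lev u e d → d ∣ D → ∃ w' : ℂ[X][X],
      w'.degree < (e : WithBot ℕ) ∧ u (toK w') = ((D : ℤ) : WithBot ℤ) := by
  have hE := exists_key hf hu hu2 hN
  intro d
  induction d using Nat.strong_induction_on with
  | _ d ih =>
  intro e hed hL hdD
  rcases d with _ | _ | m
  · simp at hed; omega
  · refine ⟨w, ?_, hwD⟩
    rw [zero_add, mul_one] at hed
    rw [hed]; exact hw
  have he : 0 < e := Nat.pos_of_ne_zero (by rintro rfl; simp at hed; omega)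
  have hPK : (toK P).Monic := hP.map _
  have hPKn : (toK P).natDegree = f.natDegree := by rw [hP.natDegree_map, hPn]
  obtain ⟨q, δ, hk, hq⟩ := exists_approx hu hf hPK hPKn (hu1 P hP0) hE e m hed hL
  have hm0 : ((m + 2 : ℕ) : ℂ) ≠ 0 := by exact_mod_cast (by omega : m + 2 ≠ 0)
  obtain ⟨Q, hQ1, hQ2, hQ3⟩ := approx_exists he hP (hPn.trans hed.symm) (C (((m + 2 : ℕ) : ℂ)⁻¹))
    (by rw [← C_eq_natCast, ← C_mul, mul_inv_cancel₀ hm0, C_1])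
  have hqQ : q = toK Q := by
    refine approx_unique (P := toK P) hk.monic (hQ1.map _) hk.deg
      (by rw [hQ1.natDegree_map, hQ2]) hq ?_
    rw [← Polynomial.map_pow, ← Polynomial.map_sub]
    rw [← degree_toK] at hQ3
    exact hQ3
  obtain ⟨d', n', δ', hd, rfl, hco, hd', hn'⟩ := split_gcd (by omega) δ hk.ndvd
  have hd2 : m + 1 + 1 = d' * n' := hd
  rw [hd] at hk
  have hlt : d' < m + 1 + 1 := by rw [hd2]; nlinarith
  have ih2 := ih d' hlt
  clear ih hlt
  rw [hd2] at hed hL hdD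
  obtain ⟨hL', -⟩ := hL.next hu hd' hk hco
  obtain ⟨w1, hw1, hw1D⟩ := ih2 (e * n') (by rw [← hed]; ring) hL'
    ((Dvd.intro _ rfl).trans hdD)
  obtain ⟨A, hA, h1⟩ := exists_rep hQ1 n' w1 (by rw [hQ2]; exact hw1)
  rw [hQ2] at hA
  have h2 : toK w1 = ∑ j ∈ Finset.range n', toK (A j) * q ^ j := by
    rw [h1, toK, Polynomial.map_sum, hqQ]
    refine Finset.sum_congr rfl fun j _ => ?_
    rw [Polynomial.map_mul, Polynomial.map_pow]
  have h3 := hu.sum_eq _ _ (hL.distinct hu hd' hk.val hco (fun j => toK (A j))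
    (fun j => by rw [degree_toK]; exact hA j))
  rw [← h2, hw1D] at h3
  obtain ⟨j, hj, h4⟩ := Finset.exists_mem_eq_sup (Finset.range n')
    ⟨0, Finset.mem_range.2 (by omega)⟩ (fun i => u (toK (A i) * q ^ i))
  rw [h4] at h3
  have hj0 : j = 0 := by
    rcases hL (toK (A j)) (by rw [degree_toK]; exact hA j) with h5 | ⟨k, h5⟩
    · rw [hu.mul, h5, WithBot.bot_add] at h3
      exact absurd h3.symm WithBot.bot_ne_coe
    · rw [hu.mul, h5, hu.pow hk.val, ← WithBot.coe_add, WithBot.coe_inj] at h3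
      obtain ⟨c, rfl⟩ := hdD
      have h6 : (n' : ℤ) ∣ (j : ℤ) * δ' := by
        refine ⟨c - k, ?_⟩
        have : (d' : ℤ) ≠ 0 := by exact_mod_cast hd'.ne'
        apply mul_left_cancel₀ this
        push_cast at h3
        linear_combination -h3
      have h7 : n' ∣ j := by exact_mod_cast hco.dvd_of_dvd_mul_right h6
      exact Nat.eq_zero_of_dvd_of_lt h7 (Finset.mem_range.1 hj)
  refine ⟨A 0, hA 0, ?_⟩
  rw [h3, hj0, pow_zero, mul_one]

theorem ams (f g : ℂ[X]) (hf : 0 < f.natDegree) (hg : 0 < g.natDegree)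
    (hs : Function.Surjective (psi f g)) :
    f.natDegree ∣ g.natDegree ∨ g.natDegree ∣ f.natDegree := by
  obtain ⟨u, hu, hu1, hu2⟩ := exists_u f g hf
  obtain ⟨P, hP, hP0, hPmin⟩ := exists_minpoly (compRingHom f) (comp_inj f hf) g (integral_elem f hf g)
  rw [degree_eq_natDegree hP.ne_zero] at hPmin
  have hPn : P.natDegree = f.natDegree := by
    apply le_antisymm
    · obtain ⟨S, h1, h2⟩ := classes hf (N := P.natDegree) (g := g) hPmin _ le_rfl
      rw [← h1]
      have : S ⊆ Finset.range f.natDegree := fun r hr => Finset.mem_range.2 (h2 r hr).1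
      simpa using Finset.card_le_card this
    · exact rank_le hf hu hu2 hs hP hP0
  have hN : ∀ F : ℂ[X][X], psi f g F = 0 → F.degree < (f.natDegree : WithBot ℕ) → F = 0 := by
    rw [← hPn]; exact hPmin
  by_cases hdvd : f.natDegree ∣ g.natDegree
  · exact Or.inl hdvd
  right
  have hL := lev_one hf hu hu2
  have hg0 : g ≠ 0 := by rintro rfl; simp at hg
  have hX : u X = ((g.natDegree : ℤ) : WithBot ℤ) := by
    have := hu2 X (by rw [psi_X]; exact hg0)
    rwa [psi_X, toK, map_X] at this
  have hk : Key u 1 f.natDegree X g.natDegree :=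
    ⟨monic_X, natDegree_X, hX, by exact_mod_cast hdvd⟩
  obtain ⟨d', n', δ', hd, hδ, hco, hd', hn'⟩ := split_gcd hf _ hk.ndvd
  have hL2 := hL
  have hk2 := hk
  rw [hd] at hL2 hk2
  rw [hδ] at hk2
  obtain ⟨hL', -⟩ := hL2.next hu hd' hk2 hco
  rw [one_mul] at hL'
  obtain ⟨w0, hw0⟩ := hs (X ^ d')
  have hw : psi f g (w0 %ₘ P) = X ^ d' := by
    have := congrArg (psi f g) (modByMonic_add_div w0 P)
    have hP0' : psi f g P = 0 := hP0
    rw [map_add, map_mul, hP0', zero_mul, add_zero, hw0] at this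
    exact this
  have hwd : (w0 %ₘ P).degree < (f.natDegree : WithBot ℕ) := by
    rw [← hPn, ← degree_eq_natDegree hP.ne_zero]; exact degree_modByMonic_lt _ hP
  obtain ⟨w', hw'1, hw'2⟩ := descend hf hu hu1 hu2 hP hP0 hPn hN (w0 %ₘ P) d' hwd
    (by rw [hu2 _ (by rw [hw]; exact pow_ne_zero _ X_ne_zero), hw, natDegree_X_pow])
    d' n' (by rw [hd, mul_comm]) hL' dvd_rfl
  obtain ⟨A, hA, h1⟩ := exists_rep (monic_X (R := ℂ[X])) n' w' (by rw [natDegree_X, one_mul]; exact hw'1)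
  rw [natDegree_X] at hA
  have h2 : toK w' = ∑ j ∈ Finset.range n', toK (A j) * X ^ j := by
    rw [h1, toK, Polynomial.map_sum]
    refine Finset.sum_congr rfl fun j _ => ?_
    rw [Polynomial.map_mul, Polynomial.map_pow, map_X]
  have h3 := hu.sum_eq _ _ (hL2.distinct hu hd' hk2.val hco (fun j => toK (A j))
    (fun j => by rw [degree_toK]; exact hA j))
  rw [← h2, hw'2] at h3
  obtain ⟨j, hj, h4⟩ := Finset.exists_mem_eq_sup (Finset.range n')
    ⟨0, Finset.mem_range.2 (by omega)⟩ (fun i => u (toK (A i) * X ^ i))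
  rw [h4, hu.mul, hu.pow hX] at h3
  by_cases h0 : psi f g (A j) = 0
  · rw [hu1 _ h0, WithBot.bot_add] at h3
    exact absurd h3.symm WithBot.bot_ne_coe
  have h5 : A j = C ((A j).coeff 0) := eq_C_of_degree_le_zero (by
    have := hA j
    by_cases h0 : A j = 0
    · rw [h0, degree_zero]; exact bot_le
    rw [degree_eq_natDegree h0] at this ⊢
    have : (A j).natDegree < 1 := by exact_mod_cast this
    exact_mod_cast (by omega : (A j).natDegree ≤ 0))
  have h6 : (psi f g (A j)).natDegree = ((A j).coeff 0).natDegree * f.natDegree := by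
    conv_lhs => rw [h5, psi_C, natDegree_comp]
  rw [hu2 _ h0, h6, ← WithBot.coe_add, WithBot.coe_inj] at h3
  have h7 : d' = ((A j).coeff 0).natDegree * f.natDegree + j * g.natDegree := by exact_mod_cast h3
  have hb : ((A j).coeff 0).natDegree = 0 := by
    by_contra hc
    have : f.natDegree ≤ ((A j).coeff 0).natDegree * f.natDegree :=
      Nat.le_mul_of_pos_left _ (Nat.pos_of_ne_zero hc)
    have : d' * 2 ≤ d' * n' := Nat.mul_le_mul_left _ hn'
    omega
  rw [hb, zero_mul, zero_add] at h7
  exact (Dvd.intro_left j h7.symm).trans ⟨n', hd⟩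

end main
end AMS

namespace AMS
open Polynomial

/-- the polynomial ring -/
abbrev A2 := MvPolynomial (Fin 2) ℂ

lemma psi_surj (φ : A2 →ₐ[ℂ] ℂ[X]) (h : Function.Surjective φ) :
    Function.Surjective (psi (φ (MvPolynomial.X 0)) (φ (MvPolynomial.X 1))) := by
  intro y
  obtain ⟨F, rfl⟩ := h y
  induction F using MvPolynomial.induction_on with
  | C a =>
    refine ⟨C (C a), ?_⟩
    rw [psi_CC]
    exact (φ.commutes a).symm
  | add p q hp hq =>
    obtain ⟨a, ha⟩ := hp
    obtain ⟨b, hb⟩ := hq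
    exact ⟨a + b, by rw [map_add, map_add, ha, hb]⟩
  | mul_X p i hp =>
    obtain ⟨a, ha⟩ := hp
    fin_cases i
    · exact ⟨a * C X, by rw [map_mul, map_mul, ha, psi_C]; simp⟩
    · exact ⟨a * X, by rw [map_mul, map_mul, ha, psi_X]; simp⟩

/-- elementary automorphism -/
noncomputable def elemAut (lam : ℂ) (k : ℕ) : A2 ≃ₐ[ℂ] A2 :=
  AlgEquiv.ofAlgHom
    (MvPolynomial.aeval ![MvPolynomial.X 0,
      MvPolynomial.X 1 - MvPolynomial.C lam * MvPolynomial.X 0 ^ k])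
    (MvPolynomial.aeval ![MvPolynomial.X 0,
      MvPolynomial.X 1 + MvPolynomial.C lam * MvPolynomial.X 0 ^ k])
    (by
      apply MvPolynomial.algHom_ext
      intro i
      fin_cases i <;> simp [MvPolynomial.algHom_C])
    (by
      apply MvPolynomial.algHom_ext
      intro i
      fin_cases i <;> simp [MvPolynomial.algHom_C])

lemma elemAut_X0 (lam : ℂ) (k : ℕ) :
    elemAut lam k (MvPolynomial.X 0) = MvPolynomial.X 0 := by
  simp [elemAut]

lemma elemAut_X1 (lam : ℂ) (k : ℕ) :
    elemAut lam k (MvPolynomial.X 1) =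
      MvPolynomial.X 1 - MvPolynomial.C lam * MvPolynomial.X 0 ^ k := by
  simp [elemAut]

/-- the swap -/
noncomputable def swp : A2 ≃ₐ[ℂ] A2 := MvPolynomial.renameEquiv ℂ (Equiv.swap 0 1)

lemma swp_X0 : swp (MvPolynomial.X 0) = MvPolynomial.X 1 := by simp [swp]
lemma swp_X1 : swp (MvPolynomial.X 1) = MvPolynomial.X 0 := by simp [swp]

/-- degree drop -/
lemma drop (f g : ℂ[X]) (hf : 0 < f.natDegree) (hg : 0 < g.natDegree)
    (hd : f.natDegree ∣ g.natDegree) :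
    ∃ lam k, (g - C lam * f ^ k).natDegree < g.natDegree := by
  obtain ⟨k, hk⟩ := hd
  have hf0 : f ≠ 0 := by rintro rfl; simp at hf
  have hg0 : g ≠ 0 := by rintro rfl; simp at hg
  have hfl : f.leadingCoeff ≠ 0 := leadingCoeff_ne_zero.2 hf0
  have hgl : g.leadingCoeff ≠ 0 := leadingCoeff_ne_zero.2 hg0
  set lam := g.leadingCoeff / f.leadingCoeff ^ k with hlam
  have hl0 : lam ≠ 0 := div_ne_zero hgl (pow_ne_zero _ hfl)
  have hn : (C lam * f ^ k).natDegree = g.natDegree := by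
    rw [natDegree_C_mul hl0, natDegree_pow, hk, mul_comm]
  have hne : C lam * f ^ k ≠ 0 := by
    intro h; rw [h] at hn; simp at hn; omega
  refine ⟨lam, k, ?_⟩
  have hlt : (g - C lam * f ^ k).degree < g.degree := by
    apply degree_sub_lt_left
    · rw [degree_eq_natDegree hg0, degree_eq_natDegree hne, hn]
    · exact hg0
    · rw [leadingCoeff_mul, leadingCoeff_C, leadingCoeff_pow, hlam, div_mul_cancel₀]
      exact pow_ne_zero _ hfl
  by_cases h0 : g - C lam * f ^ k = 0
  · rw [h0, natDegree_zero]; exact hg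
  · exact natDegree_lt_natDegree h0 hlt

lemma straighten : ∀ (N : ℕ) (φ : A2 →ₐ[ℂ] ℂ[X]), Function.Surjective φ →
    (φ (MvPolynomial.X 0)).natDegree + (φ (MvPolynomial.X 1)).natDegree ≤ N →
    ∃ (σ : A2 ≃ₐ[ℂ] A2) (c0 : ℂ), φ (σ (MvPolynomial.X 0)) = C c0 := by
  have key : ∀ (N : ℕ) (φ : A2 →ₐ[ℂ] ℂ[X]), Function.Surjective φ →
      (φ (MvPolynomial.X 0)).natDegree + (φ (MvPolynomial.X 1)).natDegree ≤ N + 1 →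
      0 < (φ (MvPolynomial.X 0)).natDegree → 0 < (φ (MvPolynomial.X 1)).natDegree →
      (φ (MvPolynomial.X 0)).natDegree ∣ (φ (MvPolynomial.X 1)).natDegree →
      (∀ (φ : A2 →ₐ[ℂ] ℂ[X]), Function.Surjective φ →
        (φ (MvPolynomial.X 0)).natDegree + (φ (MvPolynomial.X 1)).natDegree ≤ N →
        ∃ (σ : A2 ≃ₐ[ℂ] A2) (c0 : ℂ), φ (σ (MvPolynomial.X 0)) = C c0) →
      ∃ (σ : A2 ≃ₐ[ℂ] A2) (c0 : ℂ), φ (σ (MvPolynomial.X 0)) = C c0 := by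
    intro N φ hφ hN hf hg hd ih
    obtain ⟨lam, k, hlt⟩ := drop _ _ hf hg hd
    have e0 : φ (elemAut lam k (MvPolynomial.X 0)) = φ (MvPolynomial.X 0) := by rw [elemAut_X0]
    have e1 : φ (elemAut lam k (MvPolynomial.X 1)) =
        φ (MvPolynomial.X 1) - C lam * φ (MvPolynomial.X 0) ^ k := by
      have hc : φ (MvPolynomial.C lam) = C lam := φ.commutes lam
      rw [elemAut_X1, map_sub, map_mul, map_pow, hc]
    obtain ⟨σ, c0, h⟩ := ih (φ.comp (elemAut lam k).toAlgHom)
      (hφ.comp (elemAut lam k).surjective) (by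
        change (φ (elemAut lam k (MvPolynomial.X 0))).natDegree +
          (φ (elemAut lam k (MvPolynomial.X 1))).natDegree ≤ N
        rw [e0, e1]; omega)
    exact ⟨σ.trans (elemAut lam k), c0, h⟩
  intro N
  induction N with
  | zero =>
    intro φ _ h
    exact ⟨AlgEquiv.refl, _, eq_C_of_natDegree_eq_zero (by simp; omega)⟩
  | succ N ih =>
    intro φ hφ hN
    by_cases hf : (φ (MvPolynomial.X 0)).natDegree = 0
    · exact ⟨AlgEquiv.refl, _, eq_C_of_natDegree_eq_zero hf⟩
    by_cases hg : (φ (MvPolynomial.X 1)).natDegree = 0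
    · exact ⟨swp, _, eq_C_of_natDegree_eq_zero (by rw [swp_X0]; exact hg)⟩
    have hf' := Nat.pos_of_ne_zero hf
    have hg' := Nat.pos_of_ne_zero hg
    rcases ams _ _ hf' hg' (psi_surj φ hφ) with hd | hd
    · exact key N φ hφ hN hf' hg' hd ih
    · have e0 : (φ.comp swp.toAlgHom) (MvPolynomial.X 0) = φ (MvPolynomial.X 1) :=
        congrArg φ swp_X0
      have e1 : (φ.comp swp.toAlgHom) (MvPolynomial.X 1) = φ (MvPolynomial.X 0) :=
        congrArg φ swp_X1
      obtain ⟨σ, c0, h⟩ := key N (φ.comp swp.toAlgHom) (hφ.comp swp.surjective)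
        (by rw [e0, e1]; omega) (by rw [e0]; exact hg') (by rw [e1]; exact hf')
        (by rw [e0, e1]; exact hd) ih
      exact ⟨σ.trans swp, c0, h⟩

/-- evaluation on a coordinate line -/
noncomputable def lineHom (c : ℂ) : A2 →ₐ[ℂ] ℂ[X] := MvPolynomial.aeval ![C c, X]

/-- section of the evaluation -/
noncomputable def lineSec : ℂ[X] →ₐ[ℂ] A2 := Polynomial.aeval (MvPolynomial.X 1)

lemma line_sec (c : ℂ) (q : ℂ[X]) : lineHom c (lineSec q) = q := by
  have : (lineHom c).comp lineSec = AlgHom.id ℂ ℂ[X] := by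
    apply Polynomial.algHom_ext
    simp [lineHom, lineSec]
  exact DFunLike.congr_fun this q

lemma line_ker (c : ℂ) :
    RingHom.ker (lineHom c) = Ideal.span {(MvPolynomial.X 0 - MvPolynomial.C c : A2)} := by
  set I := Ideal.span {(MvPolynomial.X 0 - MvPolynomial.C c : A2)} with hI
  have h : (Ideal.Quotient.mkₐ ℂ I).comp (lineSec.comp (lineHom c)) = Ideal.Quotient.mkₐ ℂ I := by
    apply MvPolynomial.algHom_ext
    intro i
    fin_cases i
    · have : lineSec (lineHom c (MvPolynomial.X 0)) = MvPolynomial.C c := by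
        simp [lineHom, lineSec]
      change Ideal.Quotient.mk I (lineSec (lineHom c (MvPolynomial.X 0))) =
        Ideal.Quotient.mk I (MvPolynomial.X 0)
      rw [this, eq_comm, Ideal.Quotient.eq]
      exact Ideal.subset_span rfl
    · have : lineSec (lineHom c (MvPolynomial.X 1)) = MvPolynomial.X 1 := by
        simp [lineHom, lineSec]
      exact congrArg (Ideal.Quotient.mk I) this
  apply le_antisymm
  · intro F hF
    rw [RingHom.mem_ker] at hF
    have h2 : Ideal.Quotient.mk I (lineSec (lineHom c F)) = Ideal.Quotient.mk I F :=
      DFunLike.congr_fun h F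
    rw [hF, map_zero, map_zero] at h2
    exact Ideal.Quotient.eq_zero_iff_mem.1 h2.symm
  · rw [hI, Ideal.span_le, Set.singleton_subset_iff, SetLike.mem_coe, RingHom.mem_ker]
    have hc : lineHom c (MvPolynomial.C c) = C c := (lineHom c).commutes c
    rw [map_sub, hc]
    simp [lineHom]

lemma line_quot (c : ℂ) : Nonempty
    ((A2 ⧸ Ideal.span {(MvPolynomial.X 0 - MvPolynomial.C c : A2)}) ≃ₐ[ℂ] ℂ[X]) := by
  have hs : Function.Surjective (lineHom c) := fun q => ⟨_, line_sec c q⟩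
  exact ⟨(Ideal.quotientEquivAlgOfEq ℂ (line_ker c).symm).trans
    (Ideal.quotientKerAlgEquivOfSurjective hs)⟩

lemma line_prime (c : ℂ) : Prime (MvPolynomial.X 0 - MvPolynomial.C c : A2) := by
  have hne : (MvPolynomial.X 0 - MvPolynomial.C c : A2) ≠ 0 := by
    intro h
    have := congrArg (MvPolynomial.aeval (fun _ => c + 1 : Fin 2 → ℂ)) h
    simp at this
  rw [← Ideal.span_singleton_prime hne, ← line_ker]
  exact RingHom.ker_isPrime _

theorem main (p : A2) (h : Nonempty ((A2 ⧸ Ideal.span {p}) ≃ₐ[ℂ] ℂ[X])) (c : ℂ) :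
    Nonempty ((A2 ⧸ Ideal.span {p - MvPolynomial.C c}) ≃ₐ[ℂ] ℂ[X]) := by
  obtain ⟨E⟩ := h
  set φ : A2 →ₐ[ℂ] ℂ[X] := E.toAlgHom.comp (Ideal.Quotient.mkₐ ℂ (Ideal.span {p})) with hφdef
  have hφ : Function.Surjective φ := E.surjective.comp Ideal.Quotient.mk_surjective
  have hker : ∀ F, φ F = 0 ↔ p ∣ F := by
    intro F
    change E (Ideal.Quotient.mk _ F) = 0 ↔ _
    rw [map_eq_zero_iff _ E.injective, Ideal.Quotient.eq_zero_iff_mem, Ideal.mem_span_singleton]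
  obtain ⟨σ, c0, h0⟩ := straighten _ φ hφ le_rfl
  have hdv : p ∣ σ (MvPolynomial.X 0 - MvPolynomial.C c0) := by
    rw [← hker]
    have h1 : σ (MvPolynomial.C c0) = MvPolynomial.C c0 := σ.commutes c0
    have h2 : φ (MvPolynomial.C c0) = C c0 := φ.commutes c0
    rw [map_sub, map_sub, h0, h1, h2, sub_self]
  have hpu : ¬ IsUnit p := by
    intro hu
    have := (hker 1).2 (hu.dvd)
    rw [map_one] at this
    exact one_ne_zero this
  have hdv2 : σ.symm p ∣ MvPolynomial.X 0 - MvPolynomial.C c0 := by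
    have := map_dvd σ.symm hdv
    rwa [AlgEquiv.symm_apply_apply] at this
  have hass : Associated (σ.symm p) (MvPolynomial.X 0 - MvPolynomial.C c0) := by
    rcases (line_prime c0).irreducible.dvd_iff.1 hdv2 with h | h
    · exact absurd ((MulEquiv.isUnit_map σ.symm).1 h) hpu
    · exact h.symm
  obtain ⟨v, hv⟩ := hass.symm
  obtain ⟨a, ha, hav⟩ := MvPolynomial.isUnit_iff_eq_C_of_isReduced.1 v.isUnit
  have ha0 : a ≠ 0 := ha.ne_zero
  have hpc : σ.symm (p - MvPolynomial.C c) =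
      (MvPolynomial.X 0 - MvPolynomial.C (c0 + c / a)) * MvPolynomial.C a := by
    have h1 : σ.symm (MvPolynomial.C c) = MvPolynomial.C c := σ.symm.commutes c
    rw [map_sub, h1, ← hv, hav, sub_mul, sub_mul, ← MvPolynomial.C_mul, ← MvPolynomial.C_mul,
      add_mul, div_mul_cancel₀ _ ha0, MvPolynomial.C_add]
    ring
  have hI : Ideal.span {(MvPolynomial.X 0 - MvPolynomial.C (c0 + c / a) : A2)} =
      (Ideal.span {p - MvPolynomial.C c}).map (σ.symm : A2 →+* A2) := by
    rw [Ideal.map_span, Set.image_singleton]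
    change _ = Ideal.span {σ.symm (p - MvPolynomial.C c)}
    rw [hpc, Ideal.span_singleton_mul_right_unit (ha.map MvPolynomial.C)]
  obtain ⟨L⟩ := line_quot (c0 + c / a)
  exact ⟨(Ideal.quotientEquivAlg _ _ σ.symm hI).trans L⟩

end AMS


open MvPolynomial

/-- Consequence of the Abhyankar–Moh–Suzuki theorem used in the Remark of the paper:
if `ℂ[x,y]/(p) ≅ ℂ[t]` as ℂ-algebras, then every fiber of `p` is isomorphic to an affine
line, i.e. `ℂ[x,y]/(p - c) ≅ ℂ[t]` for every `c ∈ ℂ`. -/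
theorem all_fibers_are_lines
    (p : MvPolynomial (Fin 2) ℂ)
    (h : Nonempty ((MvPolynomial (Fin 2) ℂ ⧸ Ideal.span {p}) ≃ₐ[ℂ] Polynomial ℂ)) :
    ∀ c : ℂ,
      Nonempty ((MvPolynomial (Fin 2) ℂ ⧸ Ideal.span {p - C c}) ≃ₐ[ℂ] Polynomial ℂ) := by
  exact AMS.main p h
end
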